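/- arXiv:2408.07043 — 3 statements merged into one kernel-verified Lean document; each statement's English description precedes it below -/
import Mathlib

section
/- Fix b ∈ (0,3), q > 1, and c with 0 < c < 2/3 and c ≤ 2/(2+q), and set λ_c(t) = t^c/log t. Let u be a global classical H¹-bounded solution of the b-family equation. Then ∫_{10}^∞ (1/(t log t)) ∫_ℝ e^{−|x|/λ_c(t)} e^{−|x|/λ_c(t)^q} ( u(t,x)² + (∂_x u)(t,x)² ) dx dt < ∞. -/
open MeasureTheory Real Filter

/-- Convolution with the Green's function of `1 - d²/dx²` on `ℝ`. -/
noncomputable def G (f : ℝ → ℝ) (x : ℝ) : ℝ :=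
  (1 / 2) * ∫ y : ℝ, Real.exp (-|x - y|) * f y

/-- The flux of the nonlocal `b`-family equation at time `t`:
`(1/2)u² + G((b/2)u² + ((3-b)/2)(∂ₓu)²)`. -/
noncomputable def flux (b : ℝ) (u : ℝ → ℝ → ℝ) (t : ℝ) : ℝ → ℝ :=
  fun y => (1 / 2) * (u t y) ^ 2
    + G (fun z => (b / 2) * (u t z) ^ 2 + ((3 - b) / 2) * (deriv (u t) z) ^ 2) y

/-- `λ_c(t) = t^c / log t`. -/
noncomputable def lam (c t : ℝ) : ℝ := t ^ c / Real.log t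

/-- A global classical `H¹`-bounded solution of the nonlocal `b`-family equation:
`C¹` in `t`, `C²` in `x`, jointly continuous partial derivatives, solving the equation
pointwise on `(0,∞) × ℝ`, with `u(t,·), ∂ₓu(t,·) ∈ L²(ℝ)` uniformly bounded in time. -/
def IsH1BoundedSolution (b : ℝ) (u : ℝ → ℝ → ℝ) : Prop :=
  (∀ x : ℝ, ContDiff ℝ 1 fun t => u t x) ∧
  (∀ t : ℝ, ContDiff ℝ 2 (u t)) ∧
  Continuous (fun p : ℝ × ℝ => u p.1 p.2) ∧
  Continuous (fun p : ℝ × ℝ => deriv (fun s => u s p.2) p.1) ∧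
  Continuous (fun p : ℝ × ℝ => deriv (u p.1) p.2) ∧
  Continuous (fun p : ℝ × ℝ => deriv (deriv (u p.1)) p.2) ∧
  (∀ t x : ℝ, 0 < t → deriv (fun s => u s x) t + deriv (flux b u t) x = 0) ∧
  (∀ t : ℝ, 0 ≤ t → Integrable (fun x => (u t x) ^ 2)
    ∧ Integrable (fun x => (deriv (u t) x) ^ 2)) ∧
  (∃ C : ℝ, ∀ t : ℝ, 0 ≤ t → (∫ x : ℝ, ((u t x) ^ 2 + (deriv (u t) x) ^ 2)) ≤ C)

lemma aux_int_exp {a : ℝ} (ha : 0 < a) : Integrable (fun x : ℝ => Real.exp (-(a * |x|))) := by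
  have h := integrable_of_isBigO_exp_neg (f := fun x : ℝ => Real.exp (-(a * |x|))) (a := 0) ha
    (by fun_prop) (by
      apply Asymptotics.IsBigO.of_bound 1
      filter_upwards [eventually_ge_atTop 0] with x hx
      rw [abs_of_nonneg hx]; simp)
  rw [← integrableOn_univ, ← Set.Iic_union_Ioi (a := (0:ℝ))]
  refine IntegrableOn.union ?_ h
  have h2 := (integrableOn_Ici_iff_integrableOn_Ioi (μ := volume) (b := (0:ℝ))).mpr h
  have h3 : IntegrableOn (fun x : ℝ => Real.exp (-(a * |(-x)|))) (-Set.Ici 0) := h2.comp_neg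
  simpa using h3

lemma aux_integral_exp {a : ℝ} (ha : 0 < a) : ∫ x : ℝ, Real.exp (-(a * |x|)) = 2 / a := by
  rw [integral_comp_abs (f := fun x => Real.exp (-(a * x)))]
  have := integral_exp_mul_Ioi (a := -a) (by linarith) 0
  simp only [neg_mul] at this
  rw [this]; simp; ring

lemma aux_G_hasDeriv (f : ℝ → ℝ) (hc : Continuous f) (h0 : ∀ x, 0 ≤ f x) (hi : Integrable f) (x : ℝ) :
    ∃ d, HasDerivAt (G f) d x ∧ |d| ≤ G f x := by
  have hL : ∀ x, IntegrableOn (fun y => Real.exp y * f y) (Set.Iic x) := by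
    intro x
    refine Integrable.mono' (g := fun y => Real.exp x * f y) (hi.integrableOn.const_mul _)
      (by fun_prop) ?_
    refine (ae_restrict_iff' measurableSet_Iic).mpr (ae_of_all _ fun y hy => ?_)
    rw [Real.norm_of_nonneg (mul_nonneg (Real.exp_pos _).le (h0 y))]
    exact mul_le_mul_of_nonneg_right (Real.exp_le_exp.mpr hy) (h0 y)
  have hR : ∀ x, IntegrableOn (fun y => Real.exp (-y) * f y) (Set.Ioi x) := by
    intro x
    refine Integrable.mono' (g := fun y => Real.exp (-x) * f y) (hi.integrableOn.const_mul _)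
      (by fun_prop) ?_
    refine (ae_restrict_iff' measurableSet_Ioi).mpr (ae_of_all _ fun y hy => ?_)
    rw [Real.norm_of_nonneg (mul_nonneg (Real.exp_pos _).le (h0 y))]
    exact mul_le_mul_of_nonneg_right (Real.exp_le_exp.mpr (neg_le_neg (le_of_lt hy))) (h0 y)
  have eL : ∀ x y : ℝ, y ≤ x → Real.exp (-|x - y|) * f y = Real.exp (-x) * (Real.exp y * f y) := by
    intro x y hy
    rw [abs_of_nonneg (by linarith), ← mul_assoc, ← Real.exp_add]; congr 2; ring
  have eR : ∀ x y : ℝ, x < y → Real.exp (-|x - y|) * f y = Real.exp x * (Real.exp (-y) * f y) := by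
    intro x y hy
    rw [abs_of_neg (by linarith), ← mul_assoc, ← Real.exp_add]; congr 2; ring
  have key : ∀ x, G f x = (1/2) * (Real.exp (-x) * (∫ y in Set.Iic x, Real.exp y * f y)
      + Real.exp x * ∫ y in Set.Ioi x, Real.exp (-y) * f y) := by
    intro x
    unfold G
    have i1 : IntegrableOn (fun y => Real.exp (-|x - y|) * f y) (Set.Iic x) :=
      IntegrableOn.congr_fun (Integrable.const_mul (hL x) (Real.exp (-x))) (fun y hy => (eL x y hy).symm) measurableSet_Iic
    have i2 : IntegrableOn (fun y => Real.exp (-|x - y|) * f y) (Set.Ioi x) :=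
      IntegrableOn.congr_fun (Integrable.const_mul (hR x) (Real.exp x)) (fun y hy => (eR x y hy).symm) measurableSet_Ioi
    rw [← intervalIntegral.integral_Iic_add_Ioi i1 i2]
    rw [setIntegral_congr_fun measurableSet_Iic (fun y hy => eL x y hy),
      setIntegral_congr_fun measurableSet_Ioi (fun y hy => eR x y hy),
      integral_const_mul, integral_const_mul]
  have dL : HasDerivAt (fun x => ∫ y in Set.Iic x, Real.exp y * f y) (Real.exp x * f x) x := by
    have : (fun x => ∫ y in Set.Iic x, Real.exp y * f y)
        = fun x => (∫ y in Set.Iic 0, Real.exp y * f y) + ∫ y in (0:ℝ)..x, Real.exp y * f y := by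
      funext z
      rw [← intervalIntegral.integral_Iic_sub_Iic (hL 0) (hL z)]; ring
    rw [this]
    refine HasDerivAt.const_add _ ?_
    exact intervalIntegral.integral_hasDerivAt_right
      ((by fun_prop : Continuous fun y => Real.exp y * f y).intervalIntegrable _ _)
      (by apply Continuous.stronglyMeasurableAtFilter; fun_prop) (by fun_prop)
  have dR : HasDerivAt (fun x => ∫ y in Set.Ioi x, Real.exp (-y) * f y) (-(Real.exp (-x) * f x)) x := by
    have : (fun x => ∫ y in Set.Ioi x, Real.exp (-y) * f y)
        = fun x => (∫ y in Set.Ioi 0, Real.exp (-y) * f y) - ∫ y in (0:ℝ)..x, Real.exp (-y) * f y := by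
      funext z
      have := intervalIntegral.integral_Ioi_sub_Ioi' (hR 0) (hR z)
      rw [← this]; ring
    rw [this]
    refine HasDerivAt.const_sub _ ?_
    exact intervalIntegral.integral_hasDerivAt_right
      ((by fun_prop : Continuous fun y => Real.exp (-y) * f y).intervalIntegrable _ _)
      (by apply Continuous.stronglyMeasurableAtFilter; fun_prop) (by fun_prop)
  have nL : 0 ≤ Real.exp (-x) * (∫ y in Set.Iic x, Real.exp y * f y) :=
    mul_nonneg (Real.exp_pos _).le (integral_nonneg fun y => mul_nonneg (Real.exp_pos _).le (h0 y))
  have nR : 0 ≤ Real.exp x * (∫ y in Set.Ioi x, Real.exp (-y) * f y) :=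
    mul_nonneg (Real.exp_pos _).le (integral_nonneg fun y => mul_nonneg (Real.exp_pos _).le (h0 y))
  have eneg : HasDerivAt (fun x : ℝ => Real.exp (-x)) (-Real.exp (-x)) x := by
    simpa using (hasDerivAt_neg x).exp
  have D := ((eneg.mul dL).add ((Real.hasDerivAt_exp x).mul dR)).const_mul (1/2 : ℝ)
  refine ⟨_, D.congr_of_eventuallyEq (Eventually.of_forall fun z => by simp [key z]), ?_⟩
  rw [key x]
  have e1 : Real.exp (-x) * Real.exp x = 1 := by rw [← Real.exp_add]; simp
  have : ∀ P Q : ℝ, (1/2 : ℝ) * (-Real.exp (-x) * P + Real.exp (-x) * (Real.exp x * f x)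
      + (Real.exp x * Q + Real.exp x * -(Real.exp (-x) * f x)))
      = (1/2) * (Real.exp x * Q - Real.exp (-x) * P) := by intros; ring
  rw [this, abs_le]
  constructor <;> linarith

lemma aux_kernel (f : ℝ → ℝ) (hi : Integrable f) :
    Integrable (fun p : ℝ × ℝ => Real.exp (-|p.1 - p.2|) * f p.2) := by
  have h := (hi.convolution_integrand (ContinuousLinearMap.mul ℝ ℝ) (g := fun x => Real.exp (-|x|)) (μ := volume) (ν := volume)
    (by simpa using aux_int_exp one_pos))
  refine h.congr (ae_of_all _ fun p => ?_)
  simp [mul_comm]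

lemma aux_G_int (f : ℝ → ℝ) (hi : Integrable f) : Integrable (G f) := by
  exact ((aux_kernel f hi).integral_prod_left).const_mul (1/2 : ℝ)

lemma aux_shift (a : ℝ) (y : ℝ) : ∫ x : ℝ, Real.exp (-(a * |x - y|)) = ∫ x : ℝ, Real.exp (-(a * |x|)) :=
  integral_sub_right_eq_self (fun x => Real.exp (-(a * |x|))) y

lemma aux_G_integral (f : ℝ → ℝ) (hi : Integrable f) : ∫ x, G f x = ∫ x, f x := by
  unfold G
  rw [integral_const_mul, integral_integral_swap (f := fun x y => Real.exp (-|x - y|) * f y) (aux_kernel f hi)]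
  simp_rw [integral_mul_const]
  have : ∀ y : ℝ, ∫ x : ℝ, Real.exp (-|x - y|) = 2 := by
    intro y
    have := aux_shift 1 y
    rw [aux_integral_exp one_pos] at this
    simpa using this
  simp_rw [this, integral_const_mul]; ring

lemma aux_G_lower (f : ℝ → ℝ) (h0 : ∀ x, 0 ≤ f x) (hi : Integrable f) {β : ℝ} (hβ : 0 < β) :
    (1 / (1 + β)) * ∫ x, Real.exp (-(β * |x|)) * f x ≤ ∫ x, Real.exp (-(β * |x|)) * G f x := by
  have hk : Integrable (fun p : ℝ × ℝ => Real.exp (-(β * |p.1|)) * (Real.exp (-|p.1 - p.2|) * f p.2)) := by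
    refine (aux_kernel f hi).bdd_mul (c := 1) (by fun_prop) (ae_of_all _ fun p => ?_)
    rw [Real.norm_of_nonneg (Real.exp_pos _).le]
    exact Real.exp_le_one_iff.mpr (by have := mul_nonneg hβ.le (abs_nonneg p.1); linarith)
  have e : ∫ x, Real.exp (-(β * |x|)) * G f x = (1/2) * ∫ y, (∫ x, Real.exp (-(β * |x|)) * Real.exp (-|x - y|)) * f y := by
    have : ∀ x, Real.exp (-(β * |x|)) * G f x = (1/2) * ∫ y, Real.exp (-(β * |x|)) * (Real.exp (-|x - y|) * f y) := by
      intro x; unfold G; rw [integral_const_mul]; ring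
    simp_rw [this]
    rw [integral_const_mul, integral_integral_swap (f := fun x y => Real.exp (-(β * |x|)) * (Real.exp (-|x - y|) * f y)) hk]
    simp_rw [← mul_assoc, integral_mul_const]
  rw [e, ← integral_const_mul, ← integral_const_mul]
  have hx : ∀ y : ℝ, Integrable fun x => Real.exp (-(β * |x|)) * Real.exp (-|x - y|) := by
    intro y
    refine (aux_int_exp hβ).mul_bdd (c := 1) (by fun_prop) (ae_of_all _ fun p => ?_)
    rw [Real.norm_of_nonneg (Real.exp_pos _).le]
    exact Real.exp_le_one_iff.mpr (by have := (abs_nonneg (p-y)); linarith)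
  refine integral_mono ?_ ?_ fun y => ?_
  · refine Integrable.const_mul (hi.bdd_mul (c := 1) (by fun_prop) (ae_of_all _ fun p => ?_)) _
    rw [Real.norm_of_nonneg (Real.exp_pos _).le]
    exact Real.exp_le_one_iff.mpr (by have := mul_nonneg hβ.le (abs_nonneg p); linarith)
  · refine Integrable.const_mul ?_ _
    have := hk.integral_prod_right
    refine this.congr (ae_of_all _ fun y => ?_)
    simp only [← mul_assoc, integral_mul_const]
  · simp only []
    have l : Real.exp (-(β * |y|)) * (2 / (1 + β)) ≤ ∫ x, Real.exp (-(β * |x|)) * Real.exp (-|x - y|) := by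
      rw [← aux_integral_exp (by linarith : 0 < 1 + β), ← aux_shift (1+β) y, ← integral_const_mul]
      refine integral_mono (((aux_int_exp (by linarith : 0 < 1 + β)).comp_sub_right y).const_mul _) (hx y) fun x => ?_
      simp only []
      rw [← Real.exp_add, ← Real.exp_add, Real.exp_le_exp]
      have : |x| ≤ |x - y| + |y| := by simpa using abs_add_le (x - y) y
      nlinarith
    have := mul_le_mul_of_nonneg_right l (h0 y)
    have e2 : (1 / (1 + β)) * (Real.exp (-(β * |y|)) * f y) = (1/2) * (Real.exp (-(β * |y|)) * (2 / (1 + β)) * f y) := by ring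
    rw [e2]; linarith

noncomputable def auxPhi (α β x : ℝ) : ℝ :=
  Real.sign x * (Real.exp (-(α * |x|)) - Real.exp (-(β * |x|)))

lemma auxPhi_abs {α β : ℝ} (h : α ≤ β) (x : ℝ) : |auxPhi α β x| ≤ Real.exp (-(α * |x|)) := by
  unfold auxPhi
  have h1 : Real.exp (-(β * |x|)) ≤ Real.exp (-(α * |x|)) :=
    Real.exp_le_exp.mpr (neg_le_neg (mul_le_mul_of_nonneg_right h (abs_nonneg x)))
  have h2 := Real.exp_pos (-(β * |x|))
  have h3 : |Real.sign x| ≤ 1 := by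
    rcases Real.sign_apply_eq x with h | h | h <;> rw [h] <;> norm_num
  rw [abs_mul, abs_of_nonneg (a := _ - _) (by linarith)]
  nlinarith [abs_nonneg (Real.sign x)]

lemma auxPhi_deriv {α β : ℝ} (x : ℝ) :
    HasDerivAt (auxPhi α β) (β * Real.exp (-(β * |x|)) - α * Real.exp (-(α * |x|))) x := by
  refine hasDerivAt_of_hasDerivAt_of_ne' (x := 0)
    (g := fun x => β * Real.exp (-(β * |x|)) - α * Real.exp (-(α * |x|))) ?_ ?_ (by fun_prop) x
  · intro y hy
    rcases lt_or_gt_of_ne hy with h | h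
    · have e : ∀ a : ℝ, HasDerivAt (fun y => Real.exp (a * y)) (a * Real.exp (a * y)) y := by
        intro a; simpa [mul_comm] using ((hasDerivAt_id y).const_mul a).exp
      have := (e β).sub (e α)
      simp only [abs_of_neg h, mul_neg, neg_neg]
      refine this.congr_of_eventuallyEq ?_
      filter_upwards [Iio_mem_nhds h] with z hz
      simp only [Set.mem_Iio] at hz
      simp [auxPhi, Real.sign_of_neg hz, abs_of_neg hz]
    · have e : ∀ a : ℝ, HasDerivAt (fun y => Real.exp (-(a * y))) (-(a * Real.exp (-(a * y)))) y := by
        intro a; simpa [mul_comm] using ((hasDerivAt_id y).const_mul a).neg.exp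
      have := (e α).sub (e β)
      simp only [abs_of_pos h]
      refine HasDerivAt.congr_of_eventuallyEq (this.congr_deriv (by ring)) ?_
      filter_upwards [Ioi_mem_nhds h] with z hz
      simp only [Set.mem_Ioi] at hz
      simp [auxPhi, Real.sign_of_pos hz, abs_of_pos hz]
  · have h0 : auxPhi α β 0 = 0 := by simp [auxPhi]
    rw [ContinuousAt, h0]
    apply squeeze_zero_norm (a := fun x => |Real.exp (-(α * |x|)) - Real.exp (-(β * |x|))|)
    · intro x
      unfold auxPhi
      have h3 : |Real.sign x| ≤ 1 := by
        rcases Real.sign_apply_eq x with h | h | h <;> rw [h] <;> norm_num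
      rw [Real.norm_eq_abs, abs_mul]
      exact mul_le_of_le_one_left (abs_nonneg _) h3
    · have : Continuous fun x : ℝ => |Real.exp (-(α * |x|)) - Real.exp (-(β * |x|))| := by fun_prop
      simpa using this.tendsto 0

lemma auxPhi_meas (α β : ℝ) : Continuous (auxPhi α β) :=
  continuous_iff_continuousAt.mpr fun x => (auxPhi_deriv x).continuousAt

lemma aux_exp_le_one {a : ℝ} (ha : 0 ≤ a) (x : ℝ) : Real.exp (-(a * |x|)) ≤ 1 :=
  Real.exp_le_one_iff.mpr (by have := mul_nonneg ha (abs_nonneg x); linarith)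

/-- Fixed-time facts. -/
lemma aux_flux (b : ℝ) (hb : b ∈ Set.Ioo (0 : ℝ) 3) (v : ℝ → ℝ) (hv : ContDiff ℝ 2 v)
    (h1 : Integrable (fun x => (v x) ^ 2)) (h2 : Integrable (fun x => (deriv v x) ^ 2)) (C : ℝ)
    (hC : (∫ x : ℝ, ((v x) ^ 2 + (deriv v x) ^ 2)) ≤ C) (F : ℝ → ℝ)
    (hF : F = fun y => (1 / 2) * (v y) ^ 2
      + G (fun z => (b / 2) * (v z) ^ 2 + ((3 - b) / 2) * (deriv v z) ^ 2) y) :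
    Integrable (deriv F) ∧ (∫ x, |deriv F x|) ≤ 2 * C ∧
    ∀ α β : ℝ, 0 < α → α ≤ β →
      (β - α) * (min b (3 - b) / 2 / (1 + β)) *
        (∫ x, Real.exp (-(β * |x|)) * ((v x) ^ 2 + (deriv v x) ^ 2)) - α * (2 * C)
      ≤ - ∫ x, auxPhi α β x * deriv F x := by
  obtain ⟨hb0, hb3⟩ := hb
  set f : ℝ → ℝ := fun z => (b / 2) * (v z) ^ 2 + ((3 - b) / 2) * (deriv v z) ^ 2 with hf
  have cv : Continuous v := hv.continuous
  have cv' : Continuous (deriv v) := hv.continuous_deriv (by norm_num)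
  have fc : Continuous f := by fun_prop
  have f0 : ∀ x, 0 ≤ f x := fun x => by
    have : 0 ≤ 3 - b := by linarith
    positivity
  have fi : Integrable f := (h1.const_mul _).add (h2.const_mul _)
  have he : Integrable (fun x => (v x) ^ 2 + (deriv v x) ^ 2) := h1.add h2
  have fle : ∫ x, f x ≤ 3/2 * C := by
    calc ∫ x, f x ≤ ∫ x, 3/2 * ((v x) ^ 2 + (deriv v x) ^ 2) := by
          refine integral_mono fi (he.const_mul _) fun x => ?_
          simp only [hf]
          nlinarith [sq_nonneg (v x), sq_nonneg (deriv v x)]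
      _ ≤ _ := by rw [integral_const_mul]; linarith
  have Gi : Integrable (G f) := aux_G_int f fi
  have GI := aux_G_integral f fi
  have hdv : ∀ x, HasDerivAt v (deriv v x) x := fun x =>
    (hv.differentiable (by norm_num) x).hasDerivAt
  have G0 : ∀ x, 0 ≤ G f x := fun x => by
    unfold G
    exact mul_nonneg (by norm_num) (integral_nonneg fun y => mul_nonneg (Real.exp_pos _).le (f0 y))
  have hd : ∀ x, HasDerivAt F (deriv F x) x ∧
      |deriv F x| ≤ 1/2 * ((v x) ^ 2 + (deriv v x) ^ 2) + G f x := by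
    intro x
    obtain ⟨d, hd, hdl⟩ := aux_G_hasDeriv f fc f0 fi x
    have D : HasDerivAt F (v x * deriv v x + d) x := by
      rw [hF]
      have := (((hdv x).pow 2).const_mul (1/2 : ℝ)).add hd
      refine this.congr_deriv ?_
      norm_num; ring
    rw [D.deriv]
    refine ⟨D, (abs_add_le _ _).trans (add_le_add ?_ hdl)⟩
    rw [abs_le]
    constructor <;> nlinarith [sq_nonneg (v x + deriv v x), sq_nonneg (v x - deriv v x)]
  have Bi : Integrable (fun x => 1/2 * ((v x) ^ 2 + (deriv v x) ^ 2) + G f x) :=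
    (he.const_mul _).add Gi
  have BI : ∫ x, (1/2 * ((v x) ^ 2 + (deriv v x) ^ 2) + G f x) ≤ 2 * C := by
    rw [integral_add (he.const_mul _) Gi, integral_const_mul, GI]; linarith
  have dFi : Integrable (deriv F) :=
    Bi.mono' (measurable_deriv F).aestronglyMeasurable (ae_of_all _ fun x => (hd x).2)
  have Fi : Integrable F := by rw [hF]; exact (h1.const_mul _).add Gi
  have F0 : ∀ x, 0 ≤ F x := fun x => by
    rw [hF]; exact add_nonneg (by positivity) (G0 x)
  have GF : ∀ x, G f x ≤ F x := fun x => by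
    rw [hF]; have := sq_nonneg (v x); simp only []; linarith
  have FI : ∫ x, F x ≤ 2 * C := by
    refine le_trans (integral_mono Fi Bi fun x => ?_) BI
    rw [hF]; have := sq_nonneg (deriv v x); simp only []; linarith
  have bm : ∀ (a : ℝ), 0 ≤ a → ∀ g : ℝ → ℝ, Integrable g → Integrable fun x => Real.exp (-(a * |x|)) * g x := by
    intro a ha g hg
    refine hg.bdd_mul (c := 1) (by fun_prop) (ae_of_all _ fun p => ?_)
    rw [Real.norm_of_nonneg (Real.exp_pos _).le]
    exact aux_exp_le_one ha p
  refine ⟨dFi, (integral_mono dFi.abs Bi fun x => (hd x).2).trans BI, ?_⟩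
  intro α β hα hαβ
  have hβ : 0 < β := hα.trans_le hαβ
  have phib : ∀ g : ℝ → ℝ, Integrable g → Integrable (fun x => auxPhi α β x * g x) := by
    intro g hg
    refine hg.bdd_mul (c := 1) (auxPhi_meas α β).aestronglyMeasurable (ae_of_all _ fun p => ?_)
    exact (auxPhi_abs hαβ p).trans (aux_exp_le_one hα.le p)
  have e1 : Integrable fun x => β * (Real.exp (-(β * |x|)) * F x) := (bm β hβ.le F Fi).const_mul _
  have e2 : Integrable fun x => α * (Real.exp (-(α * |x|)) * F x) := (bm α hα.le F Fi).const_mul _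
  have ibp := integral_mul_deriv_eq_deriv_mul_of_integrable (u := auxPhi α β) (v := F)
    (u' := fun x => β * Real.exp (-(β * |x|)) - α * Real.exp (-(α * |x|))) (v' := deriv F)
    (fun x _ => auxPhi_deriv x) (fun x _ => (hd x).1) (phib _ dFi)
    ((e1.sub e2).congr (ae_of_all _ fun x => by simp; ring)) (phib _ Fi)
  rw [ibp, neg_neg]
  have : ∫ x, (β * Real.exp (-(β * |x|)) - α * Real.exp (-(α * |x|))) * F x
      = β * (∫ x, Real.exp (-(β * |x|)) * F x) - α * ∫ x, Real.exp (-(α * |x|)) * F x := by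
    rw [← integral_const_mul, ← integral_const_mul, ← integral_sub e1 e2]
    congr 1; funext x; ring
  rw [this]
  have k1 : ∫ x, Real.exp (-(α * |x|)) * F x ≤ 2 * C :=
    (integral_mono (bm α hα.le F Fi) Fi fun x =>
      mul_le_of_le_one_left (F0 x) (aux_exp_le_one hα.le x)).trans FI
  have k2 : (min b (3 - b) / 2 / (1 + β)) *
        (∫ x, Real.exp (-(β * |x|)) * ((v x) ^ 2 + (deriv v x) ^ 2)) ≤ ∫ x, Real.exp (-(β * |x|)) * F x := by
    calc _ = 1 / (1 + β) * ∫ x, Real.exp (-(β * |x|)) * (min b (3 - b) / 2 * ((v x) ^ 2 + (deriv v x) ^ 2)) := by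
          rw [show (fun x => Real.exp (-(β * |x|)) * (min b (3 - b) / 2 * ((v x) ^ 2 + (deriv v x) ^ 2)))
            = fun x => min b (3 - b) / 2 * (Real.exp (-(β * |x|)) * ((v x) ^ 2 + (deriv v x) ^ 2)) by funext x; ring,
            integral_const_mul]; ring
      _ ≤ 1 / (1 + β) * ∫ x, Real.exp (-(β * |x|)) * f x := by
          refine mul_le_mul_of_nonneg_left ?_ (by positivity)
          refine integral_mono (bm β hβ.le _ (he.const_mul _)) (bm β hβ.le _ fi) fun x => ?_
          refine mul_le_mul_of_nonneg_left ?_ (Real.exp_pos _).le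
          simp only [hf]
          nlinarith [sq_nonneg (v x), sq_nonneg (deriv v x), min_le_left b (3-b), min_le_right b (3-b)]
      _ ≤ ∫ x, Real.exp (-(β * |x|)) * G f x := aux_G_lower f f0 fi hβ
      _ ≤ _ := integral_mono (bm β hβ.le _ Gi) (bm β hβ.le _ Fi) fun x =>
          mul_le_mul_of_nonneg_left (GF x) (Real.exp_pos _).le
  have n0 : 0 ≤ ∫ x, Real.exp (-(β * |x|)) * F x :=
    integral_nonneg fun x => mul_nonneg (Real.exp_pos _).le (F0 x)
  have k3 := mul_le_mul_of_nonneg_left k2 (sub_nonneg.mpr hαβ)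
  nlinarith [mul_le_mul_of_nonneg_left k1 hα.le]

/-- weighted L1 bound. -/
lemma aux_CS (v : ℝ → ℝ) (cv : Continuous v) (h1 : Integrable (fun x => (v x) ^ 2)) (C : ℝ)
    (hC : ∫ x, (v x) ^ 2 ≤ C) {α κ : ℝ} (hκ : 0 < κ) (hα : α = (κ ^ 2)⁻¹) :
    Integrable (fun x => Real.exp (-(α / 2 * |x|)) * |v x|) ∧
    ∫ x, Real.exp (-(α / 2 * |x|)) * |v x| ≤ κ * (C + 2) / 2 := by
  have ha : 0 < α := by rw [hα]; positivity
  have Bi : Integrable fun x => (κ/2) * (v x) ^ 2 + (κ⁻¹/2) * Real.exp (-(α * |x|)) :=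
    (h1.const_mul _).add ((aux_int_exp ha).const_mul _)
  have hle : ∀ x, Real.exp (-(α / 2 * |x|)) * |v x| ≤ (κ/2) * (v x) ^ 2 + (κ⁻¹/2) * Real.exp (-(α * |x|)) := by
    intro x
    have : Real.exp (-(α * |x|)) = Real.exp (-(α / 2 * |x|)) ^ 2 := by
      rw [← Real.exp_nat_mul]; congr 1; push_cast; ring
    rw [this, ← sq_abs (v x)]
    generalize Real.exp (-(α / 2 * |x|)) = e
    generalize |v x| = w
    have : (κ/2) * w ^ 2 + (κ⁻¹/2) * e ^ 2 - e * w = κ⁻¹/2 * (κ * w - e)^2 := by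
      field_simp; ring
    have h' : 0 ≤ κ⁻¹/2 * (κ * w - e)^2 := by positivity
    linarith
  have hi : Integrable (fun x => Real.exp (-(α / 2 * |x|)) * |v x|) := by
    refine Bi.mono' (by fun_prop) (ae_of_all _ fun x => ?_)
    rw [Real.norm_of_nonneg (by positivity)]; exact hle x
  refine ⟨hi, (integral_mono hi Bi hle).trans ?_⟩
  rw [integral_add (h1.const_mul _) ((aux_int_exp ha).const_mul _), integral_const_mul,
    integral_const_mul, aux_integral_exp ha, hα]
  have : κ⁻¹ / 2 * (2 / (κ ^ 2)⁻¹) = κ := by field_simp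
  rw [this]; nlinarith

noncomputable def auxR (c t : ℝ) : ℝ := c / t - 1 / (t * Real.log t)
noncomputable def auxAl (q c t : ℝ) : ℝ := (lam c t ^ q)⁻¹
noncomputable def auxBe (q c t : ℝ) : ℝ := (lam c t)⁻¹ + (lam c t ^ q)⁻¹
noncomputable def auxEp (c t : ℝ) : ℝ := lam c t / (t * Real.log t)
noncomputable def auxPsi (q c t x : ℝ) : ℝ := auxEp c t * auxPhi (auxAl q c t) (auxBe q c t) x
noncomputable def auxDPsi (q c t x : ℝ) : ℝ :=
  auxEp c t * (auxR c t - 1 / t - 1 / (t * Real.log t)) * auxPhi (auxAl q c t) (auxBe q c t) x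
  + auxEp c t * (Real.sign x * (q * auxR c t * auxAl q c t * (|x| * Real.exp (-(auxAl q c t * |x|)))
    - (auxR c t * (lam c t)⁻¹ + q * auxR c t * auxAl q c t) * (|x| * Real.exp (-(auxBe q c t * |x|)))))

lemma aux_log {t : ℝ} (ht : 10 ≤ t) : 1 ≤ Real.log t := by
  rw [Real.le_log_iff_exp_le (by linarith)]
  have := Real.exp_one_lt_d9
  linarith

lemma aux_lam_ge {c t : ℝ} (hc : 0 < c) (ht : 10 ≤ t) : c ≤ lam c t := by
  unfold lam
  have hl := aux_log ht
  rw [le_div_iff₀ (by linarith)]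
  have := Real.log_le_rpow_div (by linarith : 0 ≤ t) hc
  rw [le_div_iff₀ hc] at this
  linarith

lemma aux_lam_deriv {c t : ℝ} (ht : 10 ≤ t) : HasDerivAt (lam c) (lam c t * auxR c t) t := by
  have hl := aux_log ht
  have ht0 : 0 < t := by linarith
  have h := (Real.hasDerivAt_rpow_const (x := t) (p := c) (Or.inl ht0.ne')).div
    (Real.hasDerivAt_log ht0.ne') (by linarith)
  refine HasDerivAt.congr_deriv (f := lam c) h ?_
  unfold lam auxR
  rw [Real.rpow_sub_one ht0.ne']
  field_simp

lemma aux_R_abs {c t : ℝ} (hc : 0 < c) (hc1 : c < 1) (ht : 10 ≤ t) : |auxR c t| ≤ 1 / t := by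
  have hl := aux_log ht
  have ht0 : 0 < t := by linarith
  have : auxR c t = (c - 1 / Real.log t) * (1 / t) := by unfold auxR; field_simp
  rw [this, abs_mul, abs_of_pos (a := 1 / t) (by positivity)]
  refine mul_le_of_le_one_left (by positivity) ?_
  have h1 : 1 / Real.log t ≤ 1 := by rw [div_le_one (by linarith)]; exact hl
  have h2 : 0 < 1 / Real.log t := by positivity
  rw [abs_le]; constructor <;> linarith

lemma aux_al_deriv {q c t : ℝ} (hc : 0 < c) (ht : 10 ≤ t) :
    HasDerivAt (auxAl q c) (-(q * auxR c t * auxAl q c t)) t := by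
  have hl : 0 < lam c t := hc.trans_le (aux_lam_ge hc ht)
  have h := ((aux_lam_deriv (c := c) ht).rpow_const (p := q) (Or.inl hl.ne')).inv
    (Real.rpow_pos_of_pos hl q).ne'
  refine HasDerivAt.congr_deriv (f := auxAl q c) h ?_
  unfold auxAl
  rw [Real.rpow_sub_one hl.ne']
  have := (Real.rpow_pos_of_pos hl q).ne'
  field_simp

lemma aux_be_deriv {q c t : ℝ} (hc : 0 < c) (ht : 10 ≤ t) :
    HasDerivAt (auxBe q c) (-(auxR c t * (lam c t)⁻¹ + q * auxR c t * auxAl q c t)) t := by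
  have hl : 0 < lam c t := hc.trans_le (aux_lam_ge hc ht)
  have h := ((aux_lam_deriv (c := c) ht).inv hl.ne').add (aux_al_deriv (q := q) hc ht)
  refine HasDerivAt.congr_deriv (f := auxBe q c) h ?_
  field_simp
  ring

lemma aux_ep_deriv {c t : ℝ} (ht : 10 ≤ t) :
    HasDerivAt (auxEp c) (auxEp c t * (auxR c t - 1 / t - 1 / (t * Real.log t))) t := by
  have hl := aux_log ht
  have ht0 : 0 < t := by linarith
  have h := (aux_lam_deriv (c := c) ht).div ((hasDerivAt_id t).mul (Real.hasDerivAt_log ht0.ne'))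
    (show t * Real.log t ≠ 0 from (ne_of_gt (mul_pos ht0 (by linarith))))
  refine HasDerivAt.congr_deriv (f := auxEp c) h ?_
  unfold auxEp
  simp only [id, Pi.mul_apply]
  field_simp
  ring

lemma aux_psi_deriv {q c t : ℝ} (hc : 0 < c) (ht : 10 ≤ t) (x : ℝ) :
    HasDerivAt (fun s => auxPsi q c s x) (auxDPsi q c t x) t := by
  have ha := (((aux_al_deriv (q := q) hc ht).mul_const |x|).neg).exp
  have hb := (((aux_be_deriv (q := q) hc ht).mul_const |x|).neg).exp
  have h := (aux_ep_deriv (c := c) ht).mul ((ha.sub hb).const_mul (Real.sign x))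
  refine HasDerivAt.congr_deriv (f := fun s => auxPsi q c s x) h ?_
  unfold auxDPsi auxPhi
  simp only [Pi.neg_apply, Pi.sub_apply]
  ring

lemma aux_xexp {a : ℝ} (ha : 0 < a) (x : ℝ) :
    a * (|x| * Real.exp (-(a * |x|))) ≤ 2 * Real.exp (-(a / 2 * |x|)) := by
  have h1 : a / 2 * |x| ≤ Real.exp (a / 2 * |x|) := by
    have := Real.add_one_le_exp (a / 2 * |x|); linarith
  have h2 : Real.exp (-(a * |x|)) = Real.exp (-(a/2 * |x|)) * Real.exp (-(a/2 * |x|)) := by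
    rw [← Real.exp_add]; congr 1; ring
  have h3 : Real.exp (a / 2 * |x|) * Real.exp (-(a/2 * |x|)) = 1 := by
    rw [← Real.exp_add]; simp
  have h4 := mul_le_mul_of_nonneg_right h1 (Real.exp_pos (-(a/2 * |x|))).le
  rw [h2]
  nlinarith [Real.exp_pos (-(a/2 * |x|)), mul_le_mul_of_nonneg_right (h4.trans h3.le) (Real.exp_pos (-(a/2 * |x|))).le]

lemma aux_al_pos {q c t : ℝ} (hc : 0 < c) (ht : 10 ≤ t) : 0 < auxAl q c t := by
  have hl : 0 < lam c t := hc.trans_le (aux_lam_ge hc ht)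
  unfold auxAl; positivity

lemma aux_al_le_be {q c t : ℝ} (hc : 0 < c) (ht : 10 ≤ t) : auxAl q c t ≤ auxBe q c t := by
  have hl : 0 < lam c t := hc.trans_le (aux_lam_ge hc ht)
  unfold auxAl auxBe
  have : 0 < (lam c t)⁻¹ := by positivity
  linarith

lemma aux_ep_pos {c t : ℝ} (hc : 0 < c) (ht : 10 ≤ t) : 0 < auxEp c t := by
  have hl : 0 < lam c t := hc.trans_le (aux_lam_ge hc ht)
  have := aux_log ht
  unfold auxEp; positivity

lemma aux_exp_half {a b : ℝ} (h : a ≤ b) (x : ℝ) :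
    Real.exp (-(b * |x|)) ≤ Real.exp (-(a * |x|)) :=
  Real.exp_le_exp.mpr (neg_le_neg (mul_le_mul_of_nonneg_right h (abs_nonneg x)))

lemma aux_psi_abs {q c t : ℝ} (hc : 0 < c) (ht : 10 ≤ t) (x : ℝ) :
    |auxPsi q c t x| ≤ auxEp c t * Real.exp (-(auxAl q c t / 2 * |x|)) := by
  have he := aux_ep_pos hc ht
  have ha := aux_al_pos (q := q) hc ht
  unfold auxPsi
  rw [abs_mul, abs_of_pos he]
  exact mul_le_mul_of_nonneg_left ((auxPhi_abs (aux_al_le_be hc ht) x).trans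
    (aux_exp_half (by linarith) x)) he.le

lemma aux_dpsi_abs {q c t : ℝ} (hq : 1 < q) (hc : 0 < c) (hc1 : c < 1) (ht : 10 ≤ t) (x : ℝ) :
    |auxDPsi q c t x| ≤ (3 + 4 * q) * (auxEp c t / t) * Real.exp (-(auxAl q c t / 2 * |x|)) := by
  have he := aux_ep_pos hc ht
  have ha := aux_al_pos (q := q) hc ht
  have hab := aux_al_le_be (q := q) hc ht
  have hl : 0 < lam c t := hc.trans_le (aux_lam_ge hc ht)
  have hbe : auxBe q c t = (lam c t)⁻¹ + auxAl q c t := rfl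
  have hli : 0 < (lam c t)⁻¹ := by positivity
  have hR := aux_R_abs hc hc1 ht
  have hlog := aux_log ht
  have ht0 : 0 < t := by linarith
  have hphi := (auxPhi_abs hab x).trans (aux_exp_half (by linarith : auxAl q c t / 2 ≤ auxAl q c t) x)
  have hA := aux_xexp ha x
  have hB := (aux_xexp (ha.trans_le hab) x).trans (mul_le_mul_of_nonneg_left (aux_exp_half
    (by linarith : auxAl q c t / 2 ≤ auxBe q c t / 2) x) (by norm_num : (0:ℝ) ≤ 2))
  have hs : |Real.sign x| ≤ 1 := by
    rcases Real.sign_apply_eq x with h | h | h <;> rw [h] <;> norm_num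
  have hXA : 0 ≤ |x| * Real.exp (-(auxAl q c t * |x|)) := by positivity
  have hXB : 0 ≤ |x| * Real.exp (-(auxBe q c t * |x|)) := by positivity
  have hE := Real.exp_pos (-(auxAl q c t / 2 * |x|))
  unfold auxDPsi
  generalize Real.exp (-(auxAl q c t / 2 * |x|)) = E at *
  generalize |x| * Real.exp (-(auxAl q c t * |x|)) = XA at *
  generalize |x| * Real.exp (-(auxBe q c t * |x|)) = XB at *
  generalize auxPhi (auxAl q c t) (auxBe q c t) x = P at *
  have b1 : |auxR c t - 1 / t - 1 / (t * Real.log t)| ≤ 3 / t := by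
    have h1 : 0 < 1 / t := by positivity
    have h2 : 0 < 1 / (t * Real.log t) := by positivity
    have h3 : 1 / (t * Real.log t) ≤ 1 / t :=
      one_div_le_one_div_of_le ht0 (by nlinarith)
    have h4 : 3 / t = 1 / t + 1 / t + 1 / t := by ring
    rw [abs_le] at hR ⊢
    rw [h4]
    constructor <;> linarith
  have t1 : |auxEp c t * (auxR c t - 1 / t - 1 / (t * Real.log t)) * P| ≤ auxEp c t * (3 / t) * E := by
    rw [abs_mul, abs_mul, abs_of_pos he]
    gcongr
  have u1 : |q * auxR c t * auxAl q c t * XA| ≤ q * (1 / t) * (2 * E) := by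
    have : |q * auxR c t * auxAl q c t * XA| = q * |auxR c t| * (auxAl q c t * XA) := by
      rw [abs_mul, abs_mul, abs_mul, abs_of_pos ha, abs_of_nonneg hXA, abs_of_pos (by linarith : 0 < q)]; ring
    rw [this]
    gcongr
  have u2 : |(auxR c t * (lam c t)⁻¹ + q * auxR c t * auxAl q c t) * XB| ≤ q * (1 / t) * (2 * E) := by
    have e1 : |(auxR c t * (lam c t)⁻¹ + q * auxR c t * auxAl q c t) * XB|
        = |auxR c t| * (((lam c t)⁻¹ + q * auxAl q c t) * XB) := by
      rw [show (auxR c t * (lam c t)⁻¹ + q * auxR c t * auxAl q c t) * XB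
        = auxR c t * (((lam c t)⁻¹ + q * auxAl q c t) * XB) by ring, abs_mul,
        abs_of_nonneg (a := _ * XB) (by positivity)]
    have e2 : ((lam c t)⁻¹ + q * auxAl q c t) * XB ≤ q * (auxBe q c t * XB) := by
      rw [← mul_assoc]
      refine mul_le_mul_of_nonneg_right ?_ hXB
      rw [hbe]; nlinarith
    rw [e1]
    calc _ ≤ (1 / t) * (q * (2 * E)) := by
          refine mul_le_mul hR (e2.trans ?_) (by positivity) (by positivity)
          gcongr
      _ = _ := by ring
  have t2 : |auxEp c t * (Real.sign x * (q * auxR c t * auxAl q c t * XA -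
      (auxR c t * (lam c t)⁻¹ + q * auxR c t * auxAl q c t) * XB))| ≤ auxEp c t * (1 * (q * (1 / t) * (2 * E) + q * (1 / t) * (2 * E))) := by
    rw [abs_mul, abs_mul, abs_of_pos he]
    gcongr
    exact (abs_sub _ _).trans (add_le_add u1 u2)
  refine (abs_add_le _ _).trans ((add_le_add t1 t2).trans (le_of_eq ?_))
  field_simp
  ring

lemma aux_ep_kappa {q c t : ℝ} (hq : 1 < q) (hc : 0 < c) (hcq : c ≤ 2 / (2 + q)) (ht : 10 ≤ t) :
    auxEp c t * lam c t ^ (q / 2) ≤ 1 / Real.log t ^ 2 := by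
  have hl : 0 < lam c t := hc.trans_le (aux_lam_ge hc ht)
  have hlog := aux_log ht
  have ht0 : 0 < t := by linarith
  have key : lam c t * lam c t ^ (q / 2) ≤ t / Real.log t := by
    rw [← Real.rpow_one_add' hl.le (by positivity)]
    unfold lam
    rw [Real.div_rpow (by positivity) (by linarith), ← Real.rpow_mul ht0.le]
    gcongr
    · calc t ^ (c * (1 + q / 2)) ≤ t ^ (1:ℝ) := by
            refine Real.rpow_le_rpow_of_exponent_le (by linarith) ?_
            rw [le_div_iff₀ (by linarith)] at hcq
            nlinarith
        _ = t := Real.rpow_one t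
    · calc Real.log t = Real.log t ^ (1:ℝ) := (Real.rpow_one _).symm
        _ ≤ _ := Real.rpow_le_rpow_of_exponent_le hlog (by linarith)
  unfold auxEp
  calc _ = (lam c t * lam c t ^ (q / 2)) / (t * Real.log t) := by ring
    _ ≤ (t / Real.log t) / (t * Real.log t) := by gcongr
    _ = _ := by field_simp

lemma aux_ep_al {q c t : ℝ} (hq : 1 < q) (hc : 0 < c) (ht : 10 ≤ t) :
    auxEp c t * auxAl q c t ≤ ((c * (q - 1) / q) ^ q)⁻¹ * (1 / (t * Real.log t ^ 2)) := by
  have hl : 0 < lam c t := hc.trans_le (aux_lam_ge hc ht)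
  have hlog := aux_log ht
  have ht0 : 0 < t := by linarith
  set e := c * (q - 1) / q with he
  have he0 : 0 < e := by
    have : 0 < q - 1 := by linarith
    positivity
  have h1 : Real.log t ^ q ≤ t ^ (c * (q - 1)) / e ^ q := by
    calc Real.log t ^ q ≤ (t ^ e / e) ^ q :=
          Real.rpow_le_rpow (by linarith) (Real.log_le_rpow_div ht0.le he0) (by linarith)
      _ = _ := by
          rw [Real.div_rpow (by positivity) he0.le, ← Real.rpow_mul ht0.le]
          congr 2; rw [he]; field_simp
  have h2 : lam c t * auxAl q c t = Real.log t ^ q / Real.log t / t ^ (c * (q - 1)) := by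
    unfold auxAl lam
    have hL : 0 < Real.log t := by linarith
    rw [Real.div_rpow (by positivity) (by linarith), ← Real.rpow_mul ht0.le,
      show c * q = c * (q - 1) + c by ring, Real.rpow_add ht0]
    have := (Real.rpow_pos_of_pos ht0 c).ne'
    have := (Real.rpow_pos_of_pos ht0 (c * (q-1))).ne'
    have := (Real.rpow_pos_of_pos hL q).ne'
    field_simp
  have hp := Real.rpow_pos_of_pos ht0 (c * (q-1))
  unfold auxEp
  calc _ = (lam c t * auxAl q c t) / (t * Real.log t) := by ring
    _ ≤ ((t ^ (c * (q - 1)) / e ^ q) / Real.log t / t ^ (c * (q - 1))) / (t * Real.log t) := by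
        rw [h2]; gcongr
    _ = _ := by
        have := (Real.rpow_pos_of_pos he0 q).ne'
        field_simp

lemma aux_be_le {q c t : ℝ} (hq : 1 < q) (hc : 0 < c) (ht : 10 ≤ t) :
    auxBe q c t ≤ c⁻¹ + (c ^ q)⁻¹ := by
  have hl := aux_lam_ge hc ht
  unfold auxBe
  gcongr

lemma aux_ep_le {c t : ℝ} (hc1 : c < 1) (ht : 10 ≤ t) : auxEp c t ≤ 1 := by
  have hlog := aux_log ht
  have ht0 : 0 < t := by linarith
  unfold auxEp lam
  have h : t ^ c ≤ t := by
    calc t ^ c ≤ t ^ (1:ℝ) := Real.rpow_le_rpow_of_exponent_le (by linarith) hc1.le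
      _ = t := Real.rpow_one t
  rw [div_le_one (by positivity), div_le_iff₀ (by positivity)]
  nlinarith [mul_le_mul hlog hlog (by norm_num) (by linarith)]

lemma aux_lam_meas (c : ℝ) : Measurable (lam c) := by
  unfold lam; fun_prop

lemma aux_sign_meas : Measurable Real.sign := by
  unfold Real.sign
  exact Measurable.ite measurableSet_Iio measurable_const
    (Measurable.ite measurableSet_Ioi measurable_const measurable_const)

lemma aux_psi_meas (q c : ℝ) : Measurable (fun p : ℝ × ℝ => auxPsi q c p.1 p.2) := by
  have h1 : Measurable fun p : ℝ × ℝ => lam c p.1 := (aux_lam_meas c).comp measurable_fst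
  have h2 : Measurable fun p : ℝ × ℝ => Real.sign p.2 := aux_sign_meas.comp measurable_snd
  unfold auxPsi auxEp auxPhi auxAl auxBe
  fun_prop

lemma aux_dpsi_meas (q c : ℝ) : Measurable (fun p : ℝ × ℝ => auxDPsi q c p.1 p.2) := by
  have h1 : Measurable fun p : ℝ × ℝ => lam c p.1 := (aux_lam_meas c).comp measurable_fst
  have h2 : Measurable fun p : ℝ × ℝ => Real.sign p.2 := aux_sign_meas.comp measurable_snd
  unfold auxDPsi auxEp auxPhi auxAl auxBe auxR
  fun_prop

lemma aux_ftc (v w : ℝ → ℝ → ℝ) (a T M : ℝ) (haT : a ≤ T)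
    (hder : ∀ t ∈ Set.Icc a T, ∀ x, HasDerivAt (fun s => v s x) (w t x) t)
    (hm : Measurable (fun p : ℝ × ℝ => w p.1 p.2))
    (hw : ∀ t ∈ Set.Icc a T, Integrable (w t) ∧ ∫ x, |w t x| ≤ M)
    (va : Integrable (v a)) (vT : Integrable (v T)) :
    IntervalIntegrable (fun t => ∫ x, w t x) volume a T ∧
    ∫ t in a..T, ∫ x, w t x = (∫ x, v T x) - ∫ x, v a x := by
  have hprod : Integrable (fun p : ℝ × ℝ => w p.1 p.2)
      ((volume.restrict (Set.Ioc a T)).prod volume) := by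
    rw [integrable_prod_iff hm.aestronglyMeasurable]
    constructor
    · refine (ae_restrict_iff' measurableSet_Ioc).mpr (ae_of_all _ fun t ht => ?_)
      exact (hw t (Set.Ioc_subset_Icc_self ht)).1
    · refine Integrable.mono' (g := fun _ => M) (integrable_const M) ?_ ?_
      · exact (hm.norm.stronglyMeasurable.integral_prod_right (ν := volume)).aestronglyMeasurable
      · refine (ae_restrict_iff' measurableSet_Ioc).mpr (ae_of_all _ fun t ht => ?_)
        rw [Real.norm_of_nonneg (integral_nonneg fun x => norm_nonneg _)]
        exact (hw t (Set.Ioc_subset_Icc_self ht)).2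
  refine ⟨?_, ?_⟩
  · rw [intervalIntegrable_iff_integrableOn_Ioc_of_le haT]
    exact hprod.integral_prod_left
  · rw [intervalIntegral.integral_of_le haT,
      integral_integral_swap (f := fun t x => w t x) hprod, ← integral_sub vT va]
    refine integral_congr_ae ?_
    filter_upwards [hprod.prod_left_ae] with x hx
    rw [← intervalIntegral.integral_of_le haT]
    refine intervalIntegral.integral_eq_sub_of_hasDerivAt (f := fun s => v s x) ?_ ?_
    · intro t ht
      rw [Set.uIcc_of_le haT] at ht
      exact hder t ht x
    · rw [intervalIntegrable_iff_integrableOn_Ioc_of_le haT]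
      exact hx

set_option maxHeartbeats 2000000 in
/-- For a global classical `H¹`-bounded solution of the `b`-family
equation, `q > 1`, `0 < c < 2/3`, `c ≤ 2/(2+q)`:
`∫_{10}^∞ (1/(t log t)) ∫ e^{-|x|/λ_c(t)} e^{-|x|/λ_c(t)^q} (u² + (∂ₓu)²) dx dt < ∞`. -/
theorem local_energy_time_integrability (b : ℝ) (hb : b ∈ Set.Ioo (0 : ℝ) 3)
    (q c : ℝ) (hq : 1 < q) (hc0 : 0 < c) (hc1 : c < 2 / 3) (hcq : c ≤ 2 / (2 + q))
    (u : ℝ → ℝ → ℝ) (hu : IsH1BoundedSolution b u) :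
    IntegrableOn
      (fun t : ℝ => (1 / (t * Real.log t)) *
        ∫ x : ℝ, Real.exp (-|x| / lam c t) * Real.exp (-|x| / (lam c t) ^ q) *
          ((u t x) ^ 2 + (deriv (u t) x) ^ 2))
      (Set.Ioi (10 : ℝ)) := by
  obtain ⟨hut, hux, cu, cut, cux, -, hpde, hsq_itg, C, hC⟩ := hu
  have hc1' : c < 1 := by linarith
  have hC0 : 0 ≤ C := le_trans (integral_nonneg fun x => by positivity) (hC 0 le_rfl)
  -- pointwise-in-time facts
  have hfl : ∀ t : ℝ, 10 ≤ t → _ := fun t ht => aux_flux b hb (u t) (hux t)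
    (hsq_itg t (by linarith)).1 (hsq_itg t (by linarith)).2 C (hC t (by linarith)) (flux b u t) rfl
  have hpde' : ∀ t : ℝ, 10 ≤ t → (fun x => deriv (fun s => u s x) t) = fun x => -deriv (flux b u t) x := by
    intro t ht; funext x
    have := hpde t x (by linarith); linarith
  have hut_int : ∀ t : ℝ, 10 ≤ t → Integrable (fun x => deriv (fun s => u s x) t) ∧
      ∫ x, |deriv (fun s => u s x) t| ≤ 2 * C := by
    intro t ht
    obtain ⟨h1, h2, -⟩ := hfl t ht
    have e := hpde' t ht
    have e' : (fun x => |deriv (fun s => u s x) t|) = fun x => |deriv (flux b u t) x| := by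
      funext x; rw [congrFun e x, abs_neg]
    rw [e, e']
    exact ⟨h1.neg, h2⟩
  have cuT : ∀ t, Continuous (u t) := fun t => (hux t).continuous
  have hu2 : ∀ t : ℝ, 10 ≤ t → ∫ x, (u t x) ^ 2 ≤ C := by
    intro t ht
    have hi := hsq_itg t (by linarith)
    refine le_trans (integral_mono hi.1 (hi.1.add hi.2) fun x => ?_) (hC t (by linarith))
    simp only [Pi.add_apply]
    have := sq_nonneg (deriv (u t) x); linarith
  have hκ : ∀ t : ℝ, 10 ≤ t → 0 < lam c t ^ (q / 2) ∧ auxAl q c t = ((lam c t ^ (q / 2)) ^ 2)⁻¹ := by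
    intro t ht
    have hl : 0 < lam c t := hc0.trans_le (aux_lam_ge hc0 ht)
    refine ⟨Real.rpow_pos_of_pos hl _, ?_⟩
    unfold auxAl
    rw [← Real.rpow_natCast, ← Real.rpow_mul hl.le]; congr 2; push_cast; ring
  have hcs : ∀ t : ℝ, 10 ≤ t → _ := fun t ht => aux_CS (u t) (cuT t) (hsq_itg t (by linarith)).1 C
    (hu2 t ht) (hκ t ht).1 (hκ t ht).2
  -- measurability
  have mpsi := aux_psi_meas q c
  have mdpsi := aux_dpsi_meas q c
  have msec : ∀ t, Measurable (fun x => auxPsi q c t x) := fun t => mpsi.comp measurable_prodMk_left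
  have mdsec : ∀ t, Measurable (fun x => auxDPsi q c t x) := fun t => mdpsi.comp measurable_prodMk_left
  set v : ℝ → ℝ → ℝ := fun t x => auxPsi q c t x * u t x with hv
  set w1 : ℝ → ℝ → ℝ := fun t x => auxDPsi q c t x * u t x with hw1
  set w2 : ℝ → ℝ → ℝ := fun t x => auxPsi q c t x * deriv (fun s => u s x) t with hw2
  set h : ℝ → ℝ := fun t => t⁻¹ / Real.log t ^ 2 with hh
  have hepk : ∀ t : ℝ, 10 ≤ t → auxEp c t * lam c t ^ (q / 2) ≤ 1 / Real.log t ^ 2 :=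
    fun t ht => aux_ep_kappa hq hc0 hcq ht
  have hlog1 : ∀ t : ℝ, 10 ≤ t → 1 / Real.log t ^ 2 ≤ 1 := by
    intro t ht
    have := aux_log ht
    rw [div_le_one (by positivity)]; nlinarith
  have Fv : ∀ t : ℝ, 10 ≤ t → Integrable (v t) ∧ |∫ x, v t x| ≤ (C + 2) / 2 := by
    intro t ht
    obtain ⟨ci, cI⟩ := hcs t ht
    have hb' : ∀ x, ‖v t x‖ ≤ auxEp c t * (Real.exp (-(auxAl q c t / 2 * |x|)) * |u t x|) := by
      intro x
      rw [hv, Real.norm_eq_abs, abs_mul, ← mul_assoc]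
      exact mul_le_mul_of_nonneg_right (aux_psi_abs hc0 ht x) (abs_nonneg _)
    refine ⟨(ci.const_mul (auxEp c t)).mono'
      ((msec t).mul (cuT t).measurable).aestronglyMeasurable (ae_of_all _ hb'), ?_⟩
    refine (norm_integral_le_of_norm_le (ci.const_mul (auxEp c t)) (ae_of_all _ hb')).trans ?_
    rw [integral_const_mul]
    calc _ ≤ auxEp c t * (lam c t ^ (q / 2) * (C + 2) / 2) :=
          mul_le_mul_of_nonneg_left cI (aux_ep_pos hc0 ht).le
      _ = (auxEp c t * lam c t ^ (q / 2)) * ((C + 2) / 2) := by ring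
      _ ≤ 1 * ((C + 2) / 2) := mul_le_mul_of_nonneg_right ((hepk t ht).trans (hlog1 t ht)) (by linarith)
      _ = _ := one_mul _
  have Fw1 : ∀ t : ℝ, 10 ≤ t → Integrable (w1 t) ∧
      ∫ x, |w1 t x| ≤ (3 + 4 * q) * ((C + 2) / 2) * h t := by
    intro t ht
    obtain ⟨ci, cI⟩ := hcs t ht
    have ht0 : 0 < t := by linarith
    have hb' : ∀ x, ‖w1 t x‖ ≤ ((3 + 4 * q) * (auxEp c t / t)) *
        (Real.exp (-(auxAl q c t / 2 * |x|)) * |u t x|) := by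
      intro x
      rw [hw1, Real.norm_eq_abs, abs_mul, ← mul_assoc]
      exact mul_le_mul_of_nonneg_right (aux_dpsi_abs hq hc0 hc1' ht x) (abs_nonneg _)
    have hi : Integrable (w1 t) := (ci.const_mul _).mono'
      ((mdsec t).mul (cuT t).measurable).aestronglyMeasurable (ae_of_all _ hb')
    refine ⟨hi, ?_⟩
    refine (integral_mono hi.abs (ci.const_mul _) hb').trans ?_
    rw [integral_const_mul]
    have hep := aux_ep_pos hc0 ht
    calc _ ≤ ((3 + 4 * q) * (auxEp c t / t)) * (lam c t ^ (q / 2) * (C + 2) / 2) :=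
          mul_le_mul_of_nonneg_left cI (by positivity)
      _ = (3 + 4 * q) * ((C + 2) / 2) * (t⁻¹ * (auxEp c t * lam c t ^ (q / 2))) := by
          field_simp
      _ ≤ (3 + 4 * q) * ((C + 2) / 2) * (t⁻¹ * (1 / Real.log t ^ 2)) := by
          have := hepk t ht
          gcongr
      _ = _ := by rw [hh]; ring
  have psi1 : ∀ t : ℝ, 10 ≤ t → ∀ x, |auxPsi q c t x| ≤ 1 := by
    intro t ht x
    refine (aux_psi_abs hc0 ht x).trans ?_
    have h1 := aux_exp_le_one (a := auxAl q c t / 2) (by have := aux_al_pos (q := q) hc0 ht; linarith) x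
    have h2 := aux_ep_le hc1' ht
    exact mul_le_one₀ h2 (Real.exp_pos _).le h1
  have Fw2 : ∀ t : ℝ, 10 ≤ t → Integrable (w2 t) ∧ ∫ x, |w2 t x| ≤ 2 * C := by
    intro t ht
    obtain ⟨ci, cI⟩ := hut_int t ht
    have hi : Integrable (w2 t) := ci.bdd_mul (c := 1) (msec t).aestronglyMeasurable
      (ae_of_all _ fun x => psi1 t ht x)
    refine ⟨hi, (integral_mono hi.abs ci.abs fun x => ?_).trans cI⟩
    simp only [hw2, abs_mul]
    exact mul_le_of_le_one_left (abs_nonneg _) (psi1 t ht x)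
  have h_le : ∀ t : ℝ, 10 ≤ t → h t ≤ 1 := by
    intro t ht
    have := hlog1 t ht
    have h2 : t⁻¹ ≤ 1 := inv_le_one_of_one_le₀ (by linarith)
    have h3 : 0 ≤ 1 / Real.log t ^ 2 := by positivity
    calc h t = t⁻¹ * (1 / Real.log t ^ 2) := by rw [hh]; ring
      _ ≤ 1 := mul_le_one₀ h2 h3 this
  -- the lower bound
  set I : ℝ → ℝ := fun t => ∫ x : ℝ, Real.exp (-|x| / lam c t) * Real.exp (-|x| / (lam c t) ^ q) *
          ((u t x) ^ 2 + (deriv (u t) x) ^ 2) with hI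
  have hIeq : ∀ t, I t = ∫ x, Real.exp (-(auxBe q c t * |x|)) * ((u t x) ^ 2 + (deriv (u t) x) ^ 2) := by
    intro t
    simp only [hI]
    congr 1; funext x
    rw [← Real.exp_add]
    congr 2
    unfold auxBe
    ring
  have hI0 : ∀ t, 0 ≤ I t := fun t => integral_nonneg fun x => by positivity
  set B : ℝ := c⁻¹ + (c ^ q)⁻¹ with hB
  have hB0 : 0 < B := by have := Real.rpow_pos_of_pos hc0 q; positivity
  set m : ℝ := min b (3 - b) / 2 with hm
  have hm0 : 0 < m := by
    have : 0 < min b (3 - b) := lt_min hb.1 (by linarith [hb.2])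
    positivity
  set k1 : ℝ := m / (1 + B) with hk1
  have hk10 : 0 < k1 := by positivity
  set K : ℝ := ((c * (q - 1) / q) ^ q)⁻¹ with hK
  set g : ℝ → ℝ := fun t => (1 / (t * Real.log t)) * I t with hg
  have hlow : ∀ t : ℝ, 10 ≤ t → k1 * g t - (K * (2 * C)) * h t ≤ ∫ x, w2 t x := by
    intro t ht
    obtain ⟨-, -, h3⟩ := hfl t ht
    have hep := aux_ep_pos hc0 ht
    have hal := aux_al_pos (q := q) hc0 ht
    have hab := aux_al_le_be (q := q) hc0 ht
    have hl : 0 < lam c t := hc0.trans_le (aux_lam_ge hc0 ht)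
    have hlog := aux_log ht
    have ht0 : 0 < t := by linarith
    have h4 := h3 _ _ hal hab
    rw [← hIeq t] at h4
    have e1 : ∫ x, w2 t x = auxEp c t * -∫ x, auxPhi (auxAl q c t) (auxBe q c t) x * deriv (flux b u t) x := by
      rw [← integral_neg, ← integral_const_mul]
      congr 1; funext x
      simp only [hw2]
      rw [congrFun (hpde' t ht) x]; unfold auxPsi; ring
    rw [e1]
    refine le_trans ?_ (mul_le_mul_of_nonneg_left h4 hep.le)
    have e2 : auxEp c t * (auxBe q c t - auxAl q c t) = 1 / (t * Real.log t) := by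
      have : auxBe q c t - auxAl q c t = (lam c t)⁻¹ := by unfold auxBe auxAl; ring
      rw [this]; unfold auxEp; field_simp
    have e3 : k1 ≤ m / (1 + auxBe q c t) := by
      have := aux_be_le hq hc0 ht
      have : 0 < auxBe q c t := hal.trans_le hab
      rw [hk1]; gcongr
    have e4 : auxEp c t * auxAl q c t ≤ K * h t := by
      refine (aux_ep_al hq hc0 ht).trans (le_of_eq ?_)
      rw [hh, hK]; field_simp
    have e5 : k1 * g t ≤ (m / (1 + auxBe q c t)) * g t :=
      mul_le_mul_of_nonneg_right e3 (mul_nonneg (by positivity) (hI0 t))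
    have e6 : auxEp c t * ((auxBe q c t - auxAl q c t) * (m / (1 + auxBe q c t)) * I t - auxAl q c t * (2 * C))
        = (auxEp c t * (auxBe q c t - auxAl q c t)) * (m / (1 + auxBe q c t)) * I t - (auxEp c t * auxAl q c t) * (2 * C) := by ring
    rw [e6, e2]
    have e7 : 1 / (t * Real.log t) * (m / (1 + auxBe q c t)) * I t = (m / (1 + auxBe q c t)) * g t := by
      rw [hg]; ring
    rw [e7]
    have := mul_le_mul_of_nonneg_right e4 (by linarith : 0 ≤ 2 * C)
    linarith
  set K2 : ℝ := K * (2 * C) + (3 + 4 * q) * ((C + 2) / 2) with hK2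
  have hK20 : 0 ≤ K2 := by
    have h1 : 0 ≤ c * (q - 1) / q := by
      have : 0 ≤ q - 1 := by linarith
      positivity
    have : 0 ≤ K := by rw [hK]; exact inv_nonneg.mpr (Real.rpow_nonneg h1 q)
    positivity
  have hmain : ∀ t : ℝ, 10 ≤ t → k1 * g t ≤ (∫ x, (w1 t x + w2 t x)) + K2 * h t := by
    intro t ht
    rw [integral_add (Fw1 t ht).1 (Fw2 t ht).1]
    have h1 := hlow t ht
    have h2 : -(∫ x, w1 t x) ≤ (3 + 4 * q) * ((C + 2) / 2) * h t :=
      (neg_le_abs _).trans ((abs_integral_le_integral_abs).trans (Fw1 t ht).2)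
    rw [hK2]; linarith
  have hh_itg : IntegrableOn h (Set.Ioi 10) := integrableOn_inv_div_log_sq_Ioi (by norm_num)
  have hh0 : ∀ t : ℝ, 10 ≤ t → 0 ≤ h t := by
    intro t ht
    have : 0 < t := by linarith
    rw [hh]; positivity
  have hg0 : ∀ t : ℝ, 10 ≤ t → 0 ≤ g t := by
    intro t ht
    have := aux_log ht
    have : 0 < t := by linarith
    exact mul_nonneg (by positivity) (hI0 t)
  -- measurability of g
  have gm : Measurable g := by
    have hlm' : Measurable fun p : ℝ × ℝ => lam c p.1 := (aux_lam_meas c).comp measurable_fst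
    have mu := cu.measurable
    have mux := cux.measurable
    have : Measurable fun p : ℝ × ℝ => Real.exp (-|p.2| / lam c p.1) * Real.exp (-|p.2| / (lam c p.1) ^ q) *
          ((u p.1 p.2) ^ 2 + (deriv (u p.1) p.2) ^ 2) := by fun_prop
    have hIm : Measurable I := (this.stronglyMeasurable.integral_prod_right (ν := volume)).measurable
    rw [hg]; fun_prop
  have gle : ∀ t : ℝ, 10 ≤ t → g t ≤ C := by
    intro t ht
    have hlog := aux_log ht
    have ht0 : 0 < t := by linarith
    have hbe : 0 ≤ auxBe q c t := ((aux_al_pos (q := q) hc0 ht).trans_le (aux_al_le_be hc0 ht)).le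
    have hi := hsq_itg t ht0.le
    have hi2 : Integrable (fun x => (u t x) ^ 2 + (deriv (u t) x) ^ 2) := hi.1.add hi.2
    have hIC : I t ≤ C := by
      rw [hIeq]
      refine le_trans (integral_mono (hi2.bdd_mul (c := 1) (by fun_prop) (ae_of_all _ fun x => ?_)) hi2 fun x => ?_) (hC t ht0.le)
      · rw [Real.norm_of_nonneg (Real.exp_pos _).le]; exact aux_exp_le_one hbe x
      · exact mul_le_of_le_one_left (by positivity) (aux_exp_le_one hbe x)
    have h1 : 1 / (t * Real.log t) ≤ 1 := by
      rw [div_le_one (by positivity)]; nlinarith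
    calc g t ≤ 1 * I t := mul_le_mul_of_nonneg_right h1 (hI0 t)
      _ ≤ C := by linarith
  have gint : ∀ T : ℝ, IntegrableOn g (Set.Ioc 10 T) := by
    intro T
    refine Integrable.mono' (g := fun _ => C) (integrable_const C) gm.aestronglyMeasurable ?_
    refine (ae_restrict_iff' measurableSet_Ioc).mpr (ae_of_all _ fun t ht => ?_)
    rw [Real.norm_of_nonneg (hg0 t ht.1.le)]
    exact gle t ht.1.le
  refine integrableOn_Ioi_of_intervalIntegral_norm_bounded (μ := volume) (l := atTop) (b := fun T : ℝ => T)
    (((C + 2) + K2 * ∫ t in Set.Ioi 10, h t) / k1) 10 gint tendsto_id ?_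
  filter_upwards [eventually_ge_atTop (10:ℝ)] with T hT
  have hftc := aux_ftc v (fun t x => w1 t x + w2 t x) 10 T
    ((3 + 4 * q) * ((C + 2) / 2) + 2 * C) hT ?_ ?_ ?_ (Fv 10 le_rfl).1 (Fv T hT).1
  · obtain ⟨wi, wI⟩ := hftc
    have hiT : IntervalIntegrable h volume 10 T := by
      rw [intervalIntegrable_iff_integrableOn_Ioc_of_le hT]
      exact hh_itg.mono_set Set.Ioc_subset_Ioi_self
    have giT : IntervalIntegrable g volume 10 T := by
      rw [intervalIntegrable_iff_integrableOn_Ioc_of_le hT]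
      exact gint T
    have en : ∫ t in (10:ℝ)..T, ‖g t‖ = ∫ t in (10:ℝ)..T, g t := by
      refine intervalIntegral.integral_congr fun t ht => ?_
      rw [Set.uIcc_of_le hT] at ht
      exact Real.norm_of_nonneg (hg0 t ht.1)
    change ∫ t in (10:ℝ)..T, ‖g t‖ ≤ _
    rw [en, le_div_iff₀ hk10, mul_comm, ← intervalIntegral.integral_const_mul]
    have step := intervalIntegral.integral_mono_on hT (giT.const_mul k1) (wi.add (hiT.const_mul K2))
      (fun t ht => hmain t ht.1)
    refine step.trans ?_
    rw [intervalIntegral.integral_add wi (hiT.const_mul K2), wI, intervalIntegral.integral_const_mul]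
    have hle : ∫ t in (10:ℝ)..T, h t ≤ ∫ t in Set.Ioi 10, h t := by
      rw [intervalIntegral.integral_of_le hT]
      refine setIntegral_mono_set hh_itg ?_ (ae_of_all _ Set.Ioc_subset_Ioi_self)
      exact (ae_restrict_iff' measurableSet_Ioi).mpr (ae_of_all _ fun t ht => hh0 t (le_of_lt ht))
    have a1 := (abs_le.mp (Fv 10 le_rfl).2).1
    have a2 := (abs_le.mp (Fv T hT).2).2
    have a3 := mul_le_mul_of_nonneg_left hle hK20
    linarith
  · intro t ht x
    have d1 := aux_psi_deriv (q := q) hc0 ht.1 x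
    have d2 : HasDerivAt (fun s => u s x) (deriv (fun s => u s x) t) t :=
      ((hut x).differentiable (by norm_num) t).hasDerivAt
    exact d1.mul d2
  · exact (mdpsi.mul cu.measurable).add (mpsi.mul cut.measurable)
  · intro t ht
    have f1 := Fw1 t ht.1
    have f2 := Fw2 t ht.1
    refine ⟨f1.1.add f2.1, ?_⟩
    refine (integral_mono (f1.1.add f2.1).abs (f1.1.abs.add f2.1.abs) fun x => abs_add_le _ _).trans ?_
    simp only [Pi.add_apply]
    rw [integral_add f1.1.abs f2.1.abs]
    have : (3 + 4 * q) * ((C + 2) / 2) * h t ≤ (3 + 4 * q) * ((C + 2) / 2) * 1 :=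
      mul_le_mul_of_nonneg_left (h_le t ht.1) (by positivity)
    linarith [f1.2, f2.2]
end

section
/- Fix b ∈ (0,3) and let u be a global classical H¹-bounded solution of the b-family equation. Then for every c with 0 < c < 2/3, liminf_{t→∞} ∫_{Λ_c(t)} ( u(t,x)² + (∂_x u)(t,x)² ) dx = 0. -/
open MeasureTheory Real Filter

lemma aux_kint {f : ℝ → ℝ} (hf : Integrable f) (x : ℝ) :
    Integrable (fun y => Real.exp (-|x - y|) * f y) := by
  refine hf.bdd_mul (c := 1) (by fun_prop) ?_
  filter_upwards with y
  rw [Real.norm_eq_abs, abs_of_pos (Real.exp_pos _), Real.exp_le_one_iff]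
  simp

lemma aux_expint : Integrable (fun x : ℝ => Real.exp (-|x|)) := by
  rw [← integrableOn_univ, ← Set.Iic_union_Ioi (a := (0:ℝ))]
  refine IntegrableOn.union ?_ ?_
  · refine (integrableOn_exp_Iic 0).congr_fun ?_ measurableSet_Iic
    intro x hx
    simp only [Set.mem_Iic] at hx
    simp [abs_of_nonpos hx]
  · refine (integrableOn_exp_neg_Ioi 0).congr_fun ?_ measurableSet_Ioi
    intro x hx
    simp only [Set.mem_Ioi] at hx
    simp [abs_of_pos hx]

lemma aux_Gdiff {f : ℝ → ℝ} (hf : Integrable f) (hc : Continuous f) :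
    Differentiable ℝ (G f) := by
  have h1 : ∀ x, IntegrableOn (fun y => Real.exp y * f y) (Set.Iic x) := by
    intro x
    refine (((aux_kint hf x).const_mul (Real.exp x)).integrableOn (s := Set.Iic x)).congr_fun
      ?_ measurableSet_Iic
    intro y hy
    simp only [Set.mem_Iic] at hy
    simp only
    rw [abs_of_nonneg (by linarith), ← mul_assoc, ← Real.exp_add]
    congr 2; ring
  have h2 : ∀ x, IntegrableOn (fun y => Real.exp (-y) * f y) (Set.Ioi x) := by
    intro x
    refine (((aux_kint hf x).const_mul (Real.exp (-x))).integrableOn (s := Set.Ioi x)).congr_fun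
      ?_ measurableSet_Ioi
    intro y hy
    simp only [Set.mem_Ioi] at hy
    simp only
    rw [abs_of_nonpos (by linarith), ← mul_assoc, ← Real.exp_add]
    congr 2; ring
  have key : G f = fun x => (1 / 2) * (Real.exp (-x) *
      ((∫ y in Set.Iic 0, Real.exp y * f y) + ∫ y in (0:ℝ)..x, Real.exp y * f y)
      + Real.exp x * ((∫ y in Set.Ioi 0, Real.exp (-y) * f y)
        - ∫ y in (0:ℝ)..x, Real.exp (-y) * f y)) := by
    funext x
    rw [← intervalIntegral.integral_Iic_sub_Iic (h1 0) (h1 x),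
      ← intervalIntegral.integral_Ioi_sub_Ioi' (h2 0) (h2 x), add_sub_cancel, sub_sub_cancel,
      ← integral_const_mul, ← integral_const_mul]
    unfold G
    rw [← intervalIntegral.integral_Iic_add_Ioi (b := x) (aux_kint hf x).integrableOn
      (aux_kint hf x).integrableOn]
    congr 2
    · refine setIntegral_congr_fun measurableSet_Iic ?_
      intro y hy
      simp only [Set.mem_Iic] at hy
      simp only
      rw [abs_of_nonneg (by linarith), ← mul_assoc, ← Real.exp_add]
      congr 2; ring
    · refine setIntegral_congr_fun measurableSet_Ioi ?_
      intro y hy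
      simp only [Set.mem_Ioi] at hy
      simp only
      rw [abs_of_nonpos (by linarith), ← mul_assoc, ← Real.exp_add]
      congr 2; ring
  rw [key]
  have d1 : Differentiable ℝ (fun x => ∫ y in (0:ℝ)..x, Real.exp y * f y) := fun x =>
    (intervalIntegral.integral_hasDerivAt_right
      ((Continuous.intervalIntegrable (by fun_prop) _ _))
      (Continuous.stronglyMeasurableAtFilter (by fun_prop) _ _)
      (Continuous.continuousAt (by fun_prop))).differentiableAt
  have d2 : Differentiable ℝ (fun x => ∫ y in (0:ℝ)..x, Real.exp (-y) * f y) := fun x =>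
    (intervalIntegral.integral_hasDerivAt_right
      ((Continuous.intervalIntegrable (by fun_prop) _ _))
      (Continuous.stronglyMeasurableAtFilter (by fun_prop) _ _)
      (Continuous.continuousAt (by fun_prop))).differentiableAt
  fun_prop

/-- weight of the window `(a, b]` -/
noncomputable def wgt (a b y : ℝ) : ℝ := ∫ x in Set.Ioc a b, Real.exp (-|x - y|)

lemma aux_shift_s9 (y : ℝ) : Integrable (fun x : ℝ => Real.exp (-|x - y|)) :=
  aux_expint.comp_sub_right y

lemma wgt_nonneg (a b y : ℝ) : 0 ≤ wgt a b y :=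
  integral_nonneg fun _ => (Real.exp_pos _).le

lemma wgt_le (a b y : ℝ) : wgt a b y ≤ ∫ x : ℝ, Real.exp (-|x|) := by
  rw [← integral_sub_right_eq_self (fun x : ℝ => Real.exp (-|x|)) y]
  exact setIntegral_le_integral (aux_shift_s9 y) (Eventually.of_forall fun _ => (Real.exp_pos _).le)

lemma wgt_ge (R y : ℝ) (hR : 1 ≤ R) (hy : y ∈ Set.Ioc (-R) R) :
    Real.exp (-1) ≤ wgt (-R) R y := by
  have main : ∀ a : ℝ, Set.Ioc a (a+1) ⊆ Set.Ioc (-R) R → a ≤ y → y ≤ a + 1 →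
      Real.exp (-1) ≤ wgt (-R) R y := by
    intro a hs h1 h2
    have e1 : ∫ x in Set.Ioc a (a+1), Real.exp (-1) = Real.exp (-1) := by simp
    calc Real.exp (-1) = ∫ x in Set.Ioc a (a+1), Real.exp (-1) := e1.symm
      _ ≤ ∫ x in Set.Ioc a (a+1), Real.exp (-|x - y|) := by
        refine setIntegral_mono_on (by simp) (aux_shift_s9 y).integrableOn
          measurableSet_Ioc ?_
        intro x hx
        rw [Real.exp_le_exp, neg_le_neg_iff, abs_le]
        constructor <;> linarith [hx.1, hx.2]
      _ ≤ _ := setIntegral_mono_set (aux_shift_s9 y).integrableOn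
          (Eventually.of_forall fun _ => (Real.exp_pos _).le) hs.eventuallyLE
  by_cases h : y ≤ 0
  · exact main y (Set.Ioc_subset_Ioc hy.1.le (by linarith)) le_rfl (by linarith)
  · push Not at h
    exact main (y-1) (Set.Ioc_subset_Ioc (by linarith) (by linarith [hy.2])) (by linarith)
      (by linarith)

lemma G_window {f : ℝ → ℝ} (hf : Integrable f) (a b : ℝ) :
    ∫ x in Set.Ioc a b, G f x = (1 / 2) * ∫ y, wgt a b y * f y := by
  unfold G wgt
  rw [integral_const_mul, integral_integral_swap]
  · congr 2
    funext y
    rw [integral_mul_const]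
  · have := (hf.comp_snd (volume.restrict (Set.Ioc a b)))
    refine this.bdd_mul (f := fun p : ℝ × ℝ => Real.exp (-|p.1 - p.2|)) (c := 1)
      (by fun_prop) ?_
    filter_upwards with y
    rw [Real.norm_eq_abs, abs_of_pos (Real.exp_pos _), Real.exp_le_one_iff]
    simp

lemma wgt_int {f : ℝ → ℝ} (hf : Integrable f) (a b : ℝ) :
    Integrable (fun y => wgt a b y * f y) := by
  refine hf.bdd_mul (c := ∫ x : ℝ, Real.exp (-|x|)) ?_ ?_
  · unfold wgt
    apply StronglyMeasurable.aestronglyMeasurable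
    apply StronglyMeasurable.integral_prod_left (f := fun x y : ℝ => Real.exp (-|x - y|))
    apply Continuous.stronglyMeasurable
    simp only [Function.uncurry_def]
    fun_prop
  · filter_upwards with y
    rw [Real.norm_eq_abs, abs_of_nonneg (wgt_nonneg _ _ _)]
    exact wgt_le _ _ _

lemma G_window_le {f : ℝ → ℝ} (hf : Integrable f) (h0 : ∀ y, 0 ≤ f y) (a b : ℝ) :
    ∫ x in Set.Ioc a b, G f x ≤ (1 / 2) * (∫ x : ℝ, Real.exp (-|x|)) * ∫ y, f y := by
  rw [G_window hf, mul_assoc]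
  refine mul_le_mul_of_nonneg_left ?_ (by norm_num)
  rw [← integral_const_mul]
  exact integral_mono (wgt_int hf a b) (hf.const_mul _)
    fun y => mul_le_mul_of_nonneg_right (wgt_le a b y) (h0 y)

lemma G_window_ge {f : ℝ → ℝ} (hf : Integrable f) (h0 : ∀ y, 0 ≤ f y) (R : ℝ) (hR : 1 ≤ R) :
    (1 / 2) * Real.exp (-1) * (∫ y in Set.Ioc (-R) R, f y) ≤ ∫ x in Set.Ioc (-R) R, G f x := by
  rw [G_window hf, mul_assoc, ← integral_const_mul]
  refine mul_le_mul_of_nonneg_left ?_ (by norm_num)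
  calc _ ≤ ∫ y in Set.Ioc (-R) R, wgt (-R) R y * f y := by
        refine setIntegral_mono_on (hf.const_mul _).integrableOn (wgt_int hf _ _).integrableOn
          measurableSet_Ioc ?_
        exact fun y hy => mul_le_mul_of_nonneg_right (wgt_ge R y hR hy) (h0 y)
    _ ≤ _ := setIntegral_le_integral (wgt_int hf _ _)
        (Eventually.of_forall fun y => mul_nonneg (wgt_nonneg _ _ _) (h0 y))

lemma G_nonneg {f : ℝ → ℝ} (h0 : ∀ y, 0 ≤ f y) (x : ℝ) : 0 ≤ G f x :=
  mul_nonneg (by norm_num) (integral_nonneg fun y => mul_nonneg (Real.exp_pos _).le (h0 y))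

lemma G_le {f : ℝ → ℝ} (hf : Integrable f) (h0 : ∀ y, 0 ≤ f y) (x : ℝ) :
    G f x ≤ (1 / 2) * ∫ y, f y := by
  unfold G
  refine mul_le_mul_of_nonneg_left ?_ (by norm_num)
  refine integral_mono (aux_kint hf x) hf fun y => ?_
  have : Real.exp (-|x - y|) ≤ 1 := by rw [Real.exp_le_one_iff]; simp
  simpa using mul_le_mul_of_nonneg_right this (h0 y)

/-- energy density -/
noncomputable def edens (u : ℝ → ℝ → ℝ) (t x : ℝ) : ℝ := (u t x) ^ 2 + (deriv (u t) x) ^ 2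

/-- source term -/
noncomputable def srcf (b : ℝ) (u : ℝ → ℝ → ℝ) (t z : ℝ) : ℝ :=
  (b / 2) * (u t z) ^ 2 + ((3 - b) / 2) * (deriv (u t) z) ^ 2

lemma flux_eq (b : ℝ) (u : ℝ → ℝ → ℝ) (t x : ℝ) :
    flux b u t x = (1 / 2) * (u t x) ^ 2 + G (srcf b u t) x := rfl

lemma edens_nonneg (u : ℝ → ℝ → ℝ) (t x : ℝ) : 0 ≤ edens u t x := by
  unfold edens; positivity

section sol
variable {b : ℝ} {u : ℝ → ℝ → ℝ}

lemma srcf_nonneg (hb : b ∈ Set.Ioo (0 : ℝ) 3) (t x : ℝ) : 0 ≤ srcf b u t x := by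
  obtain ⟨h1, h2⟩ := hb
  have : 0 ≤ 3 - b := by linarith
  unfold srcf; positivity

lemma srcf_le (hb : b ∈ Set.Ioo (0 : ℝ) 3) (t x : ℝ) :
    srcf b u t x ≤ 3 / 2 * edens u t x := by
  obtain ⟨h1, h2⟩ := hb
  unfold srcf edens
  nlinarith [mul_nonneg (sub_nonneg.2 h2.le) (sq_nonneg (u t x)),
    mul_nonneg h1.le (sq_nonneg (deriv (u t) x))]

lemma srcf_ge (t x : ℝ) :
    (min b (3 - b) / 2) * edens u t x ≤ srcf b u t x := by
  have h1 := min_le_left b (3 - b)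
  have h2 := min_le_right b (3 - b)
  unfold srcf edens
  nlinarith [mul_nonneg (sub_nonneg.2 h1) (sq_nonneg (u t x)),
    mul_nonneg (sub_nonneg.2 h2) (sq_nonneg (deriv (u t) x))]

lemma flux_nonneg (hb : b ∈ Set.Ioo (0 : ℝ) 3) (t x : ℝ) : 0 ≤ flux b u t x := by
  rw [flux_eq]
  have := G_nonneg (srcf_nonneg (u := u) hb t) x
  positivity

lemma edens_int (hu : IsH1BoundedSolution b u) {t : ℝ} (ht : 0 ≤ t) :
    Integrable (edens u t) := by
  obtain ⟨-, -, -, -, -, -, -, h, -⟩ := hu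
  exact (h t ht).1.add (h t ht).2

lemma srcf_int (hu : IsH1BoundedSolution b u) {t : ℝ} (ht : 0 ≤ t) :
    Integrable (srcf b u t) := by
  obtain ⟨-, -, -, -, -, -, -, h, -⟩ := hu
  exact ((h t ht).1.const_mul _).add ((h t ht).2.const_mul _)

lemma srcf_cont2 (hu : IsH1BoundedSolution b u) :
    Continuous (fun p : ℝ × ℝ => srcf b u p.1 p.2) := by
  obtain ⟨-, -, h1, -, h2, -⟩ := hu
  unfold srcf
  exact ((h1.pow 2).const_mul _).add ((h2.pow 2).const_mul _)

lemma srcf_cont (hu : IsH1BoundedSolution b u) (t : ℝ) : Continuous (srcf b u t) :=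
  (srcf_cont2 hu).comp (by fun_prop : Continuous fun x : ℝ => (t, x))

lemma u_cont (hu : IsH1BoundedSolution b u) (t : ℝ) : Continuous (u t) :=
  hu.2.2.1.comp (by fun_prop : Continuous fun x : ℝ => (t, x))

lemma flux_deriv (hu : IsH1BoundedSolution b u) {t : ℝ} (ht : 0 < t) (x : ℝ) :
    HasDerivAt (flux b u t) (-(deriv (fun s => u s x) t)) x := by
  have hd : DifferentiableAt ℝ (flux b u t) x := by
    have h1 : DifferentiableAt ℝ (G (srcf b u t)) x :=
      aux_Gdiff (srcf_int hu ht.le) (srcf_cont hu t) x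
    have h2 : DifferentiableAt ℝ (u t) x :=
      ((hu.2.1 t).differentiable (by norm_num)) x
    exact ((h2.pow 2).const_mul _).add h1
  have := hu.2.2.2.2.2.2.1 t x ht
  have h3 := hd.hasDerivAt
  rwa [show deriv (flux b u t) x = -(deriv (fun s => u s x) t) by linarith] at h3

lemma G_meas (hu : IsH1BoundedSolution b u) :
    StronglyMeasurable (fun p : ℝ × ℝ => G (srcf b u p.1) p.2) := by
  unfold G
  refine StronglyMeasurable.const_mul ?_ _
  apply StronglyMeasurable.integral_prod_right
    (f := fun (p : ℝ × ℝ) (y : ℝ) => Real.exp (-|p.2 - y|) * srcf b u p.1 y)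
  apply Continuous.stronglyMeasurable
  simp only [Function.uncurry_def]
  refine Continuous.mul (by fun_prop) ?_
  exact (srcf_cont2 hu).comp (by fun_prop : Continuous fun q : (ℝ × ℝ) × ℝ => (q.1.1, q.2))

lemma exists_bound (hb : b ∈ Set.Ioo (0 : ℝ) 3) (hu : IsH1BoundedSolution b u) :
    ∃ C : ℝ, 0 < C ∧ (∀ t, 0 ≤ t → ∫ x, edens u t x ≤ C) ∧
      (∀ t, 0 ≤ t → ∫ x, srcf b u t x ≤ C) := by
  obtain ⟨C, hC⟩ := hu.2.2.2.2.2.2.2.2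
  have hC0 : 0 ≤ C := le_trans (integral_nonneg fun x => edens_nonneg u 0 x) (hC 0 le_rfl)
  refine ⟨3 / 2 * C + 1, by positivity, fun t ht => ?_, fun t ht => ?_⟩
  · have := hC t ht
    change ∫ x, edens u t x ≤ C at this
    linarith
  · calc ∫ x, srcf b u t x ≤ ∫ x, 3 / 2 * edens u t x :=
          integral_mono (srcf_int hu ht) ((edens_int hu ht).const_mul _) (srcf_le hb t)
      _ = 3 / 2 * ∫ x, edens u t x := integral_const_mul _ _
      _ ≤ 3 / 2 * C + 1 := by
        have := hC t ht
        change ∫ x, edens u t x ≤ C at this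
        linarith

lemma flux_int1 (hb : b ∈ Set.Ioo (0 : ℝ) 3) (hu : IsH1BoundedSolution b u) {T : ℝ} (hT : 0 < T)
    (x : ℝ) : IntegrableOn (fun t => flux b u t x) (Set.Ioc T (2 * T)) := by
  obtain ⟨C, hC0, -, hC⟩ := exists_bound hb hu
  refine Integrable.add ?_ ?_
  · have : Continuous (fun t => 1 / 2 * (u t x) ^ 2) :=
      ((hu.2.2.1.comp (by fun_prop : Continuous fun t : ℝ => (t, x))).pow 2).const_mul _
    exact (this.integrableOn_Icc (a := T) (b := 2 * T)).mono_set Set.Ioc_subset_Icc_self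
  · refine Measure.integrableOn_of_bounded (M := C) (by simp) ?_ ?_
    · exact ((G_meas hu).comp_measurable
        (measurable_prodMk_right (y := x))).aestronglyMeasurable
    · refine (ae_restrict_iff' measurableSet_Ioc).2 (Eventually.of_forall fun t ht => ?_)
      have ht0 : 0 ≤ t := by linarith [ht.1]
      have h1 := G_nonneg (srcf_nonneg (u := u) hb t) x
      have h2 := G_le (srcf_int hu ht0) (srcf_nonneg (u := u) hb t) x
      change ‖G (srcf b u t) x‖ ≤ C
      rw [Real.norm_eq_abs, abs_of_nonneg h1]
      linarith [hC t ht0]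

lemma flux_int2 (hb : b ∈ Set.Ioo (0 : ℝ) 3) (hu : IsH1BoundedSolution b u) {T : ℝ} (hT : 0 < T)
    (p q : ℝ) : Integrable (Function.uncurry (flux b u))
      ((volume.restrict (Set.Ioc T (2 * T))).prod (volume.restrict (Set.Ioc p q))) := by
  obtain ⟨C, hC0, -, hC⟩ := exists_bound hb hu
  rw [Measure.prod_restrict]
  refine Integrable.add (f := fun z : ℝ × ℝ => 1 / 2 * (u z.1 z.2) ^ 2)
    (g := fun z : ℝ × ℝ => G (srcf b u z.1) z.2) ?_ ?_
  · have h1 : Continuous (fun z : ℝ × ℝ => 1 / 2 * (u z.1 z.2) ^ 2) :=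
      ((hu.2.2.1).pow 2).const_mul _
    have h2 : IntegrableOn (fun z : ℝ × ℝ => 1 / 2 * (u z.1 z.2) ^ 2)
        (Set.Icc T (2 * T) ×ˢ Set.Icc p q) (volume.prod volume) :=
      h1.continuousOn.integrableOn_compact (isCompact_Icc.prod isCompact_Icc)
    exact h2.mono_set (Set.prod_mono Set.Ioc_subset_Icc_self Set.Ioc_subset_Icc_self)
  · refine Measure.integrableOn_of_bounded (M := C) ?_ ?_ ?_
    · rw [Measure.prod_prod]
      simp [ENNReal.mul_eq_top]
    · exact (G_meas hu).aestronglyMeasurable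
    · refine (ae_restrict_iff' (measurableSet_Ioc.prod measurableSet_Ioc)).2
        (Eventually.of_forall fun z hz => ?_)
      have ht0 : 0 ≤ z.1 := by linarith [hz.1.1]
      have h1 := G_nonneg (srcf_nonneg (u := u) hb z.1) z.2
      have h2 := G_le (srcf_int hu ht0) (srcf_nonneg (u := u) hb z.1) z.2
      rw [Real.norm_eq_abs, abs_of_nonneg h1]
      linarith [hC z.1 ht0]

lemma flux_int3 (hu : IsH1BoundedSolution b u) {t : ℝ} (ht : 0 ≤ t)
    (p q : ℝ) : IntegrableOn (G (srcf b u t)) (Set.Ioc p q) := by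
  exact ((aux_Gdiff (srcf_int hu ht) (srcf_cont hu t)).continuous.integrableOn_Icc).mono_set
    Set.Ioc_subset_Icc_self

/-- time integrated flux -/
noncomputable def Phi (b : ℝ) (u : ℝ → ℝ → ℝ) (T x : ℝ) : ℝ :=
  ∫ t in Set.Ioc T (2 * T), flux b u t x

lemma Phi_sub (hb : b ∈ Set.Ioo (0 : ℝ) 3) (hu : IsH1BoundedSolution b u) {T : ℝ} (hT : 0 < T)
    {p q : ℝ} (hpq : p ≤ q) :
    Phi b u T p - Phi b u T q = ∫ x in Set.Ioc p q, (u (2 * T) x - u T x) := by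
  unfold Phi
  rw [← integral_sub (flux_int1 hb hu hT p) (flux_int1 hb hu hT q)]
  have hct := hu.2.2.2.1
  have e1 : ∀ t ∈ Set.Ioc T (2 * T), flux b u t p - flux b u t q
      = ∫ x in Set.Ioc p q, deriv (fun s => u s x) t := by
    intro t ht
    have ht0 : 0 < t := by linarith [ht.1]
    have hc : Continuous (fun x => deriv (fun s => u s x) t) :=
      hct.comp (by fun_prop : Continuous fun x : ℝ => (t, x))
    have := intervalIntegral.integral_eq_sub_of_hasDerivAt (a := p) (b := q)
      (fun x _ => flux_deriv hu ht0 x) (hc.neg.intervalIntegrable _ _)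
    rw [intervalIntegral.integral_of_le hpq, integral_neg] at this
    linarith
  rw [setIntegral_congr_fun measurableSet_Ioc e1, integral_integral_swap]
  · refine setIntegral_congr_fun measurableSet_Ioc ?_
    intro x _
    simp only
    have hc : Continuous (fun t => deriv (fun s => u s x) t) :=
      hct.comp (by fun_prop : Continuous fun t : ℝ => (t, x))
    have := intervalIntegral.integral_eq_sub_of_hasDerivAt (a := T) (b := 2 * T)
      (fun t _ => (((hu.1 x).differentiable (by norm_num)) t).hasDerivAt)
      (hc.intervalIntegrable _ _)
    rwa [intervalIntegral.integral_of_le (by linarith)] at this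
  · rw [Measure.prod_restrict]
    have h2 : IntegrableOn (Function.uncurry fun t x => deriv (fun s => u s x) t)
        (Set.Icc T (2 * T) ×ˢ Set.Icc p q) (volume.prod volume) :=
      hct.continuousOn.integrableOn_compact (isCompact_Icc.prod isCompact_Icc)
    exact h2.mono_set (Set.prod_mono Set.Ioc_subset_Icc_self Set.Ioc_subset_Icc_self)

lemma mass_bound (hu : IsH1BoundedSolution b u) {C : ℝ}
    (hC : ∀ t, 0 ≤ t → ∫ x, edens u t x ≤ C) {t : ℝ} (ht : 0 ≤ t) {p q s : ℝ} (hpq : p ≤ q)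
    (hs : 0 < s) : ∫ x in Set.Ioc p q, |u t x| ≤ (s * C + (q - p) / s) / 2 := by
  have hei := edens_int hu ht
  calc ∫ x in Set.Ioc p q, |u t x| ≤ ∫ x in Set.Ioc p q, (s / 2 * edens u t x + 1 / (2 * s)) := by
        refine integral_mono ?_ ?_ ?_
        · exact ((u_cont hu t).abs.integrableOn_Icc).mono_set Set.Ioc_subset_Icc_self
        · exact (hei.const_mul _).integrableOn.add (integrable_const _)
        · intro x
          simp only [edens]
          have h1 : |u t x| ≤ s / 2 * (u t x) ^ 2 + 1 / (2 * s) := by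
            have : 0 ≤ (s * |u t x| - 1) ^ 2 / (2 * s) := by positivity
            have h3 : (s * |u t x| - 1) ^ 2 / (2 * s)
                = s / 2 * |u t x| ^ 2 + 1 / (2 * s) - |u t x| := by
              field_simp; ring
            rw [sq_abs] at h3
            linarith
          have h2 : 0 ≤ s / 2 * (deriv (u t) x) ^ 2 := by positivity
          linarith
    _ = s / 2 * (∫ x in Set.Ioc p q, edens u t x) + (q - p) / (2 * s) := by
        rw [integral_add (hei.const_mul _).integrableOn (integrable_const _), integral_const_mul]
        simp [hpq]
        field_simp
    _ ≤ s / 2 * C + (q - p) / (2 * s) := by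
        gcongr
        exact (setIntegral_le_integral hei
          (Eventually.of_forall fun x => edens_nonneg u t x)).trans (hC t ht)
    _ = _ := by field_simp

lemma Phi_le (hb : b ∈ Set.Ioo (0 : ℝ) 3) (hu : IsH1BoundedSolution b u) {C : ℝ}
    (hC : ∀ t, 0 ≤ t → ∫ x, edens u t x ≤ C) {T : ℝ} (hT : 0 < T)
    {p q s : ℝ} (hpq : p ≤ q) (hs : 0 < s) :
    Phi b u T p ≤ Phi b u T q + (s * C + (q - p) / s) := by
  have h := Phi_sub hb hu hT hpq
  have i1 : ∀ t, IntegrableOn (u t) (Set.Ioc p q) := fun t =>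
    ((u_cont hu t).integrableOn_Icc).mono_set Set.Ioc_subset_Icc_self
  rw [integral_sub (i1 _) (i1 _)] at h
  have h1 := mass_bound hu hC (t := 2 * T) (by linarith) hpq hs
  have h2 := mass_bound hu hC (t := T) (by linarith) hpq hs
  have h3 := abs_le.1 (abs_integral_le_integral_abs (f := u (2 * T))
    (μ := volume.restrict (Set.Ioc p q)))
  have h4 := abs_le.1 (abs_integral_le_integral_abs (f := u T)
    (μ := volume.restrict (Set.Ioc p q)))
  linarith [h3.2, h4.1]

lemma Phi_swap (hb : b ∈ Set.Ioo (0 : ℝ) 3) (hu : IsH1BoundedSolution b u) {T : ℝ} (hT : 0 < T)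
    (p q : ℝ) : ∫ x in Set.Ioc p q, Phi b u T x
      = ∫ t in Set.Ioc T (2 * T), ∫ x in Set.Ioc p q, flux b u t x :=
  (integral_integral_swap (flux_int2 hb hu hT p q)).symm

lemma Phi_int (hb : b ∈ Set.Ioo (0 : ℝ) 3) (hu : IsH1BoundedSolution b u) {T : ℝ} (hT : 0 < T)
    (p q : ℝ) : IntegrableOn (Phi b u T) (Set.Ioc p q) :=
  (flux_int2 hb hu hT p q).integral_prod_right

lemma flux_intt (hb : b ∈ Set.Ioo (0 : ℝ) 3) (hu : IsH1BoundedSolution b u) {T : ℝ} (hT : 0 < T)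
    (p q : ℝ) : IntegrableOn (fun t => ∫ x in Set.Ioc p q, flux b u t x) (Set.Ioc T (2 * T)) :=
  (flux_int2 hb hu hT p q).integral_prod_left

lemma flux_window (hu : IsH1BoundedSolution b u) {t : ℝ} (ht : 0 ≤ t) (p q : ℝ) :
    ∫ x in Set.Ioc p q, flux b u t x
      = (∫ x in Set.Ioc p q, 1 / 2 * (u t x) ^ 2) + ∫ x in Set.Ioc p q, G (srcf b u t) x := by
  have h1 : Integrable (fun x => 1 / 2 * (u t x) ^ 2) :=
    (hu.2.2.2.2.2.2.2.1 t ht).1.const_mul _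
  exact integral_add h1.integrableOn (flux_int3 hu ht p q)

lemma flux_window_le (hb : b ∈ Set.Ioo (0 : ℝ) 3) (hu : IsH1BoundedSolution b u) :
    ∃ K : ℝ, 0 < K ∧ ∀ t, 0 ≤ t → ∀ p q, ∫ x in Set.Ioc p q, flux b u t x ≤ K := by
  obtain ⟨C, hC0, hC1, hC2⟩ := exists_bound hb hu
  have hM : 0 ≤ ∫ x : ℝ, Real.exp (-|x|) := integral_nonneg fun _ => (Real.exp_pos _).le
  refine ⟨C + 1 / 2 * (∫ x : ℝ, Real.exp (-|x|)) * C, by positivity, fun t ht p q => ?_⟩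
  rw [flux_window hu ht]
  have h1 : Integrable (fun x => 1 / 2 * (u t x) ^ 2) :=
    (hu.2.2.2.2.2.2.2.1 t ht).1.const_mul _
  gcongr
  · calc _ ≤ ∫ x, 1 / 2 * (u t x) ^ 2 :=
          setIntegral_le_integral h1 (Eventually.of_forall fun x => by positivity)
      _ ≤ ∫ x, edens u t x := by
          refine integral_mono h1 (edens_int hu ht) fun x => ?_
          simp only [edens]
          nlinarith [sq_nonneg (u t x), sq_nonneg (deriv (u t) x)]
      _ ≤ C := hC1 t ht
  · refine (G_window_le (srcf_int hu ht) (srcf_nonneg hb t) p q).trans ?_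
    exact mul_le_mul_of_nonneg_left (hC2 t ht) (by positivity)

lemma flux_window_ge (hb : b ∈ Set.Ioo (0 : ℝ) 3) (hu : IsH1BoundedSolution b u) :
    ∃ k : ℝ, 0 < k ∧ ∀ t, 0 ≤ t → ∀ R, 1 ≤ R →
      k * (∫ x in Set.Ioc (-R) R, edens u t x) ≤ ∫ x in Set.Ioc (-R) R, flux b u t x := by
  have hm : 0 < min b (3 - b) := lt_min hb.1 (by linarith [hb.2])
  refine ⟨1 / 2 * Real.exp (-1) * (min b (3 - b) / 2), by positivity, fun t ht R hR => ?_⟩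
  rw [flux_window hu ht]
  have h0 : 0 ≤ ∫ x in Set.Ioc (-R) R, 1 / 2 * (u t x) ^ 2 :=
    integral_nonneg fun x => by positivity
  have h1 := G_window_ge (srcf_int hu ht) (srcf_nonneg hb t) R hR
  have h2 : (min b (3 - b) / 2) * (∫ x in Set.Ioc (-R) R, edens u t x)
      ≤ ∫ x in Set.Ioc (-R) R, srcf b u t x := by
    rw [← integral_const_mul]
    exact integral_mono ((edens_int hu ht).const_mul _).integrableOn
      (srcf_int hu ht).integrableOn (srcf_ge t)
  have h3 := mul_le_mul_of_nonneg_left h2 (by positivity : 0 ≤ 1 / 2 * Real.exp (-1))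
  rw [← mul_assoc] at h3
  linarith

/-- The key inequality. -/
lemma key_ineq (hb : b ∈ Set.Ioo (0 : ℝ) 3) (hu : IsH1BoundedSolution b u) :
    ∃ k K C : ℝ, 0 < k ∧ 0 < K ∧ 0 < C ∧ ∀ T R A ε : ℝ, 0 < T → 1 ≤ R → 0 < A →
      (∀ t ∈ Set.Ioc T (2 * T), ε ≤ ∫ x in Set.Ioc (-R) R, edens u t x) →
      k * ε * T ≤ 2 * R * (K * T / (A * R) + Real.sqrt R * (C + 2 + A)) := by
  obtain ⟨C, hC0, hC1, -⟩ := exists_bound hb hu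
  obtain ⟨K, hK0, hK⟩ := flux_window_le hb hu
  obtain ⟨k, hk0, hk⟩ := flux_window_ge hb hu
  refine ⟨k, K, C, hk0, hK0, hC0, fun T R A ε hT hR hA hε => ?_⟩
  have hR0 : 0 < R := by linarith
  have hAR : 0 < A * R := by positivity
  have hvol : volume.real (Set.Ioc T (2 * T)) = T := by
    rw [Real.volume_real_Ioc_of_le (by linarith)]; ring
  -- lower bound
  have low : k * ε * T ≤ ∫ x in Set.Ioc (-R) R, Phi b u T x := by
    rw [Phi_swap hb hu hT]
    calc k * ε * T = ∫ t in Set.Ioc T (2 * T), k * ε := by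
          rw [setIntegral_const, hvol, smul_eq_mul]; ring
      _ ≤ _ := by
        refine setIntegral_mono_on (integrable_const _) (flux_intt hb hu hT _ _) measurableSet_Ioc ?_
        intro t ht
        exact (mul_le_mul_of_nonneg_left (hε t ht) hk0.le).trans
          (hk t (by linarith [ht.1]) R hR)
  -- choice of a good point
  have good : ∃ y ∈ Set.Ioc R (R + A * R), Phi b u T y ≤ K * T / (A * R) := by
    by_contra hcon
    push Not at hcon
    have up : ∫ x in Set.Ioc R (R + A * R), Phi b u T x ≤ K * T := by
      rw [Phi_swap hb hu hT]
      calc _ ≤ ∫ t in Set.Ioc T (2 * T), K := by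
            refine setIntegral_mono_on (flux_intt hb hu hT _ _) (integrable_const _) measurableSet_Ioc ?_
            intro t ht
            exact hK t (by linarith [ht.1]) _ _
        _ = K * T := by rw [setIntegral_const, hvol, smul_eq_mul]; ring
    have hi : IntegrableOn (fun x => Phi b u T x - K * T / (A * R)) (Set.Ioc R (R + A * R)) :=
      (Phi_int hb hu hT _ _).sub (integrable_const _)
    have hpos : 0 < ∫ x in Set.Ioc R (R + A * R), (Phi b u T x - K * T / (A * R)) := by
      rw [← intervalIntegral.integral_of_le (by linarith)]
      refine intervalIntegral.intervalIntegral_pos_of_pos_on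
        ((intervalIntegrable_iff_integrableOn_Ioc_of_le (by linarith)).2 hi) ?_ (by linarith)
      intro x hx
      linarith [hcon x ⟨hx.1, hx.2.le⟩]
    rw [integral_sub (Phi_int hb hu hT _ _) (integrable_const _), setIntegral_const, smul_eq_mul] at hpos
    have hv : volume.real (Set.Ioc R (R + A * R)) = A * R := by simp [hAR.le]
    rw [hv, mul_div_cancel₀ _ hAR.ne'] at hpos
    linarith
  obtain ⟨y, hy, hPy⟩ := good
  have hs : 0 < Real.sqrt R := Real.sqrt_pos.2 hR0
  have ptw : ∀ a ∈ Set.Ioc (-R) R,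
      Phi b u T a ≤ K * T / (A * R) + Real.sqrt R * (C + 2 + A) := by
    intro a ha
    have h1 := Phi_le hb hu hC1 hT (p := a) (q := y) (by linarith [ha.2, hy.1]) hs
    have h2 : (y - a) / Real.sqrt R ≤ Real.sqrt R * (2 + A) := by
      rw [div_le_iff₀ hs]
      have : Real.sqrt R * Real.sqrt R = R := Real.mul_self_sqrt hR0.le
      calc y - a ≤ R * (2 + A) := by linarith [ha.1, hy.2]
        _ = Real.sqrt R * (2 + A) * Real.sqrt R := by
          rw [mul_right_comm, this]
    linarith
  refine low.trans ?_
  calc ∫ x in Set.Ioc (-R) R, Phi b u T x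
      ≤ ∫ x in Set.Ioc (-R) R, (K * T / (A * R) + Real.sqrt R * (C + 2 + A)) :=
        setIntegral_mono_on (Phi_int hb hu hT _ _) (integrable_const _) measurableSet_Ioc ptw
    _ = _ := by
      rw [setIntegral_const, smul_eq_mul]
      have : volume.real (Set.Ioc (-R) R) = 2 * R := by simp [hR0.le]; ring
      rw [this]

end sol

theorem local_energy_liminf (b : ℝ) (hb : b ∈ Set.Ioo (0 : ℝ) 3)
    (u : ℝ → ℝ → ℝ) (hu : IsH1BoundedSolution b u)
    (c : ℝ) (hc0 : 0 < c) (hc1 : c < 2 / 3) :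
    Filter.liminf
      (fun t : ℝ =>
        ∫ x in Set.Ioo (-(lam c t)) (lam c t),
          ((u t x) ^ 2 + (deriv (u t) x) ^ 2))
      Filter.atTop = 0 := by
  change Filter.liminf (fun t : ℝ => ∫ x in Set.Ioo (-(lam c t)) (lam c t), edens u t x) atTop = 0
  obtain ⟨C₁, -, hC₁, -⟩ := exists_bound hb hu
  have hnn : ∀ t, 0 ≤ ∫ x in Set.Ioo (-(lam c t)) (lam c t), edens u t x := fun t =>
    integral_nonneg fun x => edens_nonneg u t x
  have hle : ∀ᶠ t in atTop, ∫ x in Set.Ioo (-(lam c t)) (lam c t), edens u t x ≤ C₁ := by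
    filter_upwards [eventually_ge_atTop 0] with t ht
    exact (setIntegral_le_integral (edens_int hu ht)
          (Eventually.of_forall fun x => edens_nonneg u t x)).trans (hC₁ t ht)
  have hbdd : IsBoundedUnder (· ≥ ·) atTop
      (fun t : ℝ => ∫ x in Set.Ioo (-(lam c t)) (lam c t), edens u t x) :=
    isBoundedUnder_of_eventually_ge (Eventually.of_forall hnn)
  have hcob : IsCoboundedUnder (· ≥ ·) atTop
      (fun t : ℝ => ∫ x in Set.Ioo (-(lam c t)) (lam c t), edens u t x) :=
    IsBoundedUnder.isCoboundedUnder_ge (isBoundedUnder_of_eventually_le hle)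
  refine le_antisymm ?_ (le_liminf_of_le hcob (Eventually.of_forall hnn))
  by_contra hcon
  push Not at hcon
  obtain ⟨ε, hε0, hε⟩ := exists_between hcon
  have hev := eventually_lt_of_lt_liminf hε hbdd
  obtain ⟨T₀, hT₀⟩ := eventually_atTop.1 hev
  obtain ⟨k, K, C, hk, hK, hC, key⟩ := key_ineq hb hu
  obtain ⟨A, hA0, hA⟩ : ∃ A : ℝ, 0 < A ∧ 2 * K / A = k * ε / 4 :=
    ⟨8 * K / (k * ε), by positivity, by field_simp; norm_num⟩
  -- decay of the error term
  have hlim : Tendsto (fun T : ℝ => (2 * T) ^ (-(1 - 3 / 2 * c)) * (4 * (C + 2 + A)))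
      atTop (nhds 0) := by
    have h1 : Tendsto (fun T : ℝ => 2 * T) atTop atTop :=
      tendsto_id.const_mul_atTop (by norm_num)
    have h2 := (tendsto_rpow_neg_atTop (y := 1 - 3 / 2 * c) (by linarith)).comp h1
    simpa using h2.mul_const (4 * (C + 2 + A))
  have hsmall := hlim.eventually_lt_const (by positivity : 0 < k * ε / 4)
  obtain ⟨T, hT1, hT2, hT3⟩ := (hsmall.and ((eventually_ge_atTop T₀).and
    (eventually_ge_atTop (Real.exp 1)))).exists
  have hTe : 1 < T := lt_of_lt_of_le (by simp) hT3
  have hT : 0 < T := by linarith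
  have h2T : 0 < 2 * T := by linarith
  have hR : 1 ≤ (2 * T) ^ c := Real.one_le_rpow (by linarith) hc0.le
  have hR0 : 0 < (2 * T) ^ c := by linarith
  have h := key T ((2 * T) ^ c) A ε hT hR hA0 (by
    intro t ht
    have ht0 : 0 < t := by linarith [ht.1]
    refine (hT₀ t (by linarith [ht.1])).le.trans ?_
    have hlog : 1 ≤ Real.log t := by
      rw [Real.le_log_iff_exp_le ht0]; linarith [ht.1]
    have hlam : lam c t ≤ (2 * T) ^ c := by
      unfold lam
      calc t ^ c / Real.log t ≤ t ^ c := div_le_self (by positivity) hlog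
        _ ≤ (2 * T) ^ c := Real.rpow_le_rpow ht0.le ht.2 hc0.le
    refine setIntegral_mono_set (edens_int hu ht0.le).integrableOn
      (Eventually.of_forall fun x => edens_nonneg u t x) (HasSubset.Subset.eventuallyLE ?_)
    exact fun x hx => ⟨by linarith [hx.1], by linarith [hx.2]⟩)
  have hpow : (2 * T) ^ c * Real.sqrt ((2 * T) ^ c) = 2 * T * (2 * T) ^ (-(1 - 3 / 2 * c)) := by
    rw [Real.sqrt_eq_rpow, ← Real.rpow_mul h2T.le, ← Real.rpow_add h2T]
    nth_rewrite 2 [← Real.rpow_one (2 * T)]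
    rw [← Real.rpow_add h2T]
    congr 1; ring
  have h' : k * ε * T ≤ T * (2 * K / A)
      + T * ((2 * T) ^ (-(1 - 3 / 2 * c)) * (4 * (C + 2 + A))) := by
    refine h.trans (le_of_eq ?_)
    have e1 : 2 * (2 * T) ^ c * (K * T / (A * (2 * T) ^ c)) = T * (2 * K / A) := by
      field_simp
    rw [mul_add, e1]
    have e2 : 2 * (2 * T) ^ c * (Real.sqrt ((2 * T) ^ c) * (C + 2 + A))
        = 2 * ((2 * T) ^ c * Real.sqrt ((2 * T) ^ c)) * (C + 2 + A) := by ring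
    rw [e2, hpow]
    ring
  rw [hA] at h'
  have h3 := mul_lt_mul_of_pos_left hT1 hT
  have h4 : 0 < k * ε * T := by positivity
  linarith
end

section
/- Fix b ∈ (0,3) and let u be a global classical H² solution with nonnegative momentum of the b-family equation. Set λ(t) = t^{1/2}/log t. Then there exists t₀ > e such that ∫_{t₀}^∞ (1/λ(t)) ∫_ℝ sech²(x/λ(t)) ( u(t,x)² + (∂_x u)(t,x)² ) dx dt < ∞. -/
open MeasureTheory Real Filter

/-- The momentum `m = u - ∂ₓ²u`. -/
noncomputable def mom (u : ℝ → ℝ → ℝ) (t x : ℝ) : ℝ :=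
  u t x - deriv (deriv (u t)) x

/-- `sech² z`. -/
noncomputable def sech2 (z : ℝ) : ℝ := (1 / Real.cosh z) ^ 2

/-- A global classical `H²` solution with nonnegative momentum of the nonlocal `b`-family
equation: `C¹` in `t`, `C³` in `x`, jointly continuous partial derivatives, solving the
equation pointwise on `(0,∞) × ℝ`, with `u(t,·), ∂ₓu(t,·), ∂ₓ²u(t,·) ∈ L¹(ℝ) ∩ L²(ℝ)`,
nonnegative momentum `m(t,·) ≥ 0`, and conserved total momentum
`∫ m(t,x) dx = ∫ m(0,x) dx`. -/
def IsH2NonnegMomentumSolution (b : ℝ) (u : ℝ → ℝ → ℝ) : Prop :=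
  (∀ x : ℝ, ContDiff ℝ 1 fun t => u t x) ∧
  (∀ t : ℝ, ContDiff ℝ 3 (u t)) ∧
  Continuous (fun p : ℝ × ℝ => u p.1 p.2) ∧
  Continuous (fun p : ℝ × ℝ => deriv (fun s => u s p.2) p.1) ∧
  Continuous (fun p : ℝ × ℝ => deriv (u p.1) p.2) ∧
  Continuous (fun p : ℝ × ℝ => deriv (deriv (u p.1)) p.2) ∧
  Continuous (fun p : ℝ × ℝ => deriv (fun s => deriv (u s) p.2) p.1) ∧
  Continuous (fun p : ℝ × ℝ => deriv (fun s => deriv (deriv (u s)) p.2) p.1) ∧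
  (∀ t x : ℝ, 0 < t → deriv (fun s => u s x) t + deriv (flux b u t) x = 0) ∧
  (∀ t : ℝ, 0 ≤ t →
    Integrable (u t) ∧ Integrable (fun x => (u t x) ^ 2)
    ∧ Integrable (deriv (u t)) ∧ Integrable (fun x => (deriv (u t) x) ^ 2)
    ∧ Integrable (deriv (deriv (u t))) ∧ Integrable (fun x => (deriv (deriv (u t)) x) ^ 2)) ∧
  (∀ t x : ℝ, 0 ≤ t → 0 ≤ mom u t x) ∧
  (∀ t : ℝ, 0 ≤ t → ∫ x : ℝ, mom u t x = ∫ x : ℝ, mom u 0 x)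


lemma H_spatial {v : ℝ → ℝ} (hv : ContDiff ℝ 3 v) (h0 : Integrable v) (h1 : Integrable (deriv v))
    (h2 : Integrable (deriv (deriv v))) (hm : ∀ x, 0 ≤ v x - deriv (deriv v) x) :
    (∀ x, |deriv v x| ≤ v x) ∧ (∫ x, v x = ∫ x, (v x - deriv (deriv v) x)) ∧
    (∀ x, v x ≤ ∫ y, v y) ∧ Tendsto v atTop (nhds 0) ∧ Tendsto v atBot (nhds 0) := by
  have hd0 : ∀ x, HasDerivAt v (deriv v x) x := fun x =>
    (hv.differentiable (by norm_num) x).hasDerivAt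
  have hv1 : ContDiff ℝ 2 (deriv v) := ((contDiff_succ_iff_deriv (n := 2)).1 hv).2.2
  have hd1 : ∀ x, HasDerivAt (deriv v) (deriv (deriv v) x) x := fun x =>
    (hv1.differentiable (by norm_num) x).hasDerivAt
  have t0 : Tendsto v atTop (nhds 0) := tendsto_zero_of_hasDerivAt_of_integrableOn_Ioi (a := 0)
    (fun x _ => hd0 x) h1.integrableOn h0.integrableOn
  have b0 : Tendsto v atBot (nhds 0) := tendsto_zero_of_hasDerivAt_of_integrableOn_Iic (a := 0)
    (fun x _ => hd0 x) h1.integrableOn h0.integrableOn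
  have t1 : Tendsto (deriv v) atTop (nhds 0) := tendsto_zero_of_hasDerivAt_of_integrableOn_Ioi
    (a := 0) (fun x _ => hd1 x) h2.integrableOn h1.integrableOn
  have b1 : Tendsto (deriv v) atBot (nhds 0) := tendsto_zero_of_hasDerivAt_of_integrableOn_Iic
    (a := 0) (fun x _ => hd1 x) h2.integrableOn h1.integrableOn
  have A : ∀ x, deriv v x ≤ v x := by
    have hd : ∀ x, HasDerivAt (fun x => exp x * (v x - deriv v x))
        (exp x * (v x - deriv (deriv v) x)) x := by
      intro x
      refine ((Real.hasDerivAt_exp x).mul ((hd0 x).sub (hd1 x))).congr_deriv ?_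
      simp only [Pi.sub_apply]
      ring
    have mono : Monotone (fun x => exp x * (v x - deriv v x)) :=
      monotone_of_hasDerivAt_nonneg hd (fun x => mul_nonneg (exp_pos x).le (hm x))
    have lim : Tendsto (fun x => exp x * (v x - deriv v x)) atBot (nhds 0) := by
      simpa using Real.tendsto_exp_atBot.mul (b0.sub b1)
    intro x
    have := mono.le_of_tendsto lim x
    have := nonneg_of_mul_nonneg_right this (exp_pos x)
    linarith
  have B : ∀ x, -deriv v x ≤ v x := by
    have hd : ∀ x, HasDerivAt (fun x => exp (-x) * (v x + deriv v x))
        (-(exp (-x) * (v x - deriv (deriv v) x))) x := by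
      intro x
      refine ((HasDerivAt.exp (hasDerivAt_neg x)).mul ((hd0 x).add (hd1 x))).congr_deriv ?_
      simp only [Pi.add_apply]
      ring
    have mono : Antitone (fun x => exp (-x) * (v x + deriv v x)) :=
      antitone_of_hasDerivAt_nonpos hd
        (fun x => neg_nonpos.2 (mul_nonneg (exp_pos _).le (hm x)))
    have lim : Tendsto (fun x => exp (-x) * (v x + deriv v x)) atTop (nhds 0) := by
      simpa using (Real.tendsto_exp_atBot.comp tendsto_neg_atTop_atBot).mul (t0.add t1)
    intro x
    have := mono.le_of_tendsto lim x
    have := nonneg_of_mul_nonneg_right this (exp_pos (-x))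
    linarith
  have AB : ∀ x, |deriv v x| ≤ v x := fun x => abs_le.2 ⟨by linarith [B x], A x⟩
  have nn : ∀ x, 0 ≤ v x := fun x => (abs_nonneg _).trans (AB x)
  refine ⟨AB, ?_, ?_, t0, b0⟩
  · rw [integral_sub h0 h2, integral_eq_zero_of_hasDerivAt_of_integrable hd1 h2 h1, sub_zero]
  · intro x
    have := integral_Iic_of_hasDerivAt_of_tendsto (a := x) (hd0 x).continuousAt.continuousWithinAt
      (fun y _ => hd0 y) h1.integrableOn b0
    rw [sub_zero] at this
    rw [← this]
    calc _ ≤ ∫ y in Set.Iic x, v y :=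
          integral_mono h1.integrableOn h0.integrableOn (fun y => A y)
      _ ≤ _ := setIntegral_le_integral h0 (Eventually.of_forall nn)

lemma H_int {f : ℝ → ℝ} (hi : Integrable f) (x : ℝ) :
    Integrable (fun y => exp (-|x - y|) * f y) := by
  refine hi.bdd_mul (c := 1) (Continuous.aestronglyMeasurable (by fun_prop)) ?_
  refine Eventually.of_forall fun y => ?_
  rw [Real.norm_eq_abs, abs_of_pos (exp_pos _)]
  exact exp_le_one_iff.2 (neg_nonpos.2 (abs_nonneg _))

lemma H_diff {f : ℝ → ℝ} (hi : Integrable f) : Differentiable ℝ (G f) := by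
  intro x
  have key := hasDerivAt_integral_of_dominated_loc_of_lip (μ := volume) (𝕜 := ℝ)
    (F := fun x y => exp (-|x - y|) * f y) (x₀ := x) (s := Set.univ) (bound := fun y => f y)
    (F' := fun y => deriv (fun x => exp (-|x - y|)) x * f y) Filter.univ_mem
    (Eventually.of_forall fun z => (H_int hi z).aestronglyMeasurable) (H_int hi x) ?_ ?_ hi ?_
  · exact (key.2.differentiableAt.const_mul (1/2))
  · refine AEStronglyMeasurable.mul ?_ hi.aestronglyMeasurable
    have : Measurable (fun p : ℝ × ℝ => deriv (fun x => exp (-|x - p.1|)) p.2) :=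
      measurable_deriv_with_param (f := fun y x => exp (-|x - y|)) (by
        simp only [Function.uncurry_def]; fun_prop)
    exact (this.comp (measurable_id.prodMk measurable_const)).aestronglyMeasurable
  · refine Eventually.of_forall fun y => LipschitzOnWith.of_dist_le_mul fun a _ b _ => ?_
    simp only [Real.dist_eq, coe_nnabs]
    rw [← sub_mul, abs_mul, mul_comm]
    refine mul_le_mul_of_nonneg_left ?_ (abs_nonneg _)
    have h1 : ∀ p q : ℝ, 0 ≤ p → 0 ≤ q → exp (-p) - exp (-q) ≤ |p - q| := by
      intro p q hp hq
      have e1 : exp (-p) ≤ 1 := exp_le_one_iff.2 (by linarith)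
      have e2 : 1 + (p - q) ≤ exp (p - q) := by linarith [add_one_le_exp (p-q)]
      have e3 : exp (-q) = exp (-p) * exp (p - q) := by rw [← exp_add]; ring_nf
      rw [e3]
      have e4 := exp_pos (-p)
      have e5 := neg_abs_le (p - q)
      nlinarith [mul_le_mul_of_nonneg_left e2 e4.le, abs_nonneg (p-q)]
    have h2 := abs_abs_sub_abs_le_abs_sub (a - y) (b - y)
    rw [show a - y - (b - y) = a - b by ring] at h2
    refine le_trans (abs_le.2 ⟨?_, h1 _ _ (abs_nonneg _) (abs_nonneg _)⟩) h2
    have := h1 (|b - y|) (|a - y|) (abs_nonneg _) (abs_nonneg _)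
    rw [abs_sub_comm |b - y|] at this
    linarith
  · have : ∀ᵐ y : ℝ, y ≠ x := by
      simp [ae_iff]
    filter_upwards [this] with y hy
    have hne : x - y ≠ 0 := sub_ne_zero.2 (Ne.symm hy)
    have : DifferentiableAt ℝ (fun x => exp (-|x - y|)) x := by
      apply DifferentiableAt.exp
      apply DifferentiableAt.neg
      exact (differentiableAt_abs hne).comp x (by fun_prop : DifferentiableAt ℝ (fun x => x - y) x)
    exact this.hasDerivAt.mul_const _

lemma H_nonneg {f : ℝ → ℝ} (h : ∀ x, 0 ≤ f x) (x : ℝ) : 0 ≤ G f x :=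
  mul_nonneg (by norm_num) (integral_nonneg fun y => mul_nonneg (exp_pos _).le (h y))

lemma H_le {f : ℝ → ℝ} (hi : Integrable f) (h : ∀ x, 0 ≤ f x) (x : ℝ) :
    G f x ≤ (1/2) * ∫ y, f y := by
  refine mul_le_mul_of_nonneg_left (integral_mono (H_int hi x) hi fun y => ?_) (by norm_num)
  exact mul_le_of_le_one_left (h y) (exp_le_one_iff.2 (neg_nonpos.2 (abs_nonneg _)))

lemma H_lim {f : ℝ → ℝ} (hi : Integrable f) {l : Filter ℝ} [l.IsCountablyGenerated]
    (hl : ∀ y, Tendsto (fun x : ℝ => |x - y|) l atTop) :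
    Tendsto (G f) l (nhds 0) := by
  have : Tendsto (fun x => ∫ y, exp (-|x - y|) * f y) l (nhds (∫ y : ℝ, (0:ℝ))) := by
    refine tendsto_integral_filter_of_dominated_convergence (fun y => ‖f y‖)
      (Eventually.of_forall fun z => (H_int hi z).aestronglyMeasurable)
      (Eventually.of_forall fun z => Eventually.of_forall fun y => ?_) hi.norm
      (Eventually.of_forall fun y => ?_)
    · rw [norm_mul, Real.norm_eq_abs (exp _), abs_of_pos (exp_pos _)]
      exact mul_le_of_le_one_left (norm_nonneg _) (exp_le_one_iff.2 (neg_nonpos.2 (abs_nonneg _)))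
    · have := (Real.tendsto_exp_atBot.comp (tendsto_neg_atTop_atBot.comp (hl y))).mul_const (f y)
      simpa using this
  have h := this.const_mul (1/2)
  simp only [integral_zero, mul_zero] at h
  exact h

lemma H_tanh (x : ℝ) : HasDerivAt Real.tanh (sech2 x) x := by
  have h := (Real.hasDerivAt_sinh x).div (Real.hasDerivAt_cosh x) (Real.cosh_pos x).ne'
  have e : Real.tanh = fun x => Real.sinh x / Real.cosh x := by
    funext x; exact Real.tanh_eq_sinh_div_cosh x
  rw [e]
  refine h.congr_deriv ?_
  have := Real.cosh_sq x
  have c := (Real.cosh_pos x).ne'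
  unfold sech2
  field_simp
  linarith

lemma H_sech_nonneg (x : ℝ) : 0 ≤ sech2 x := sq_nonneg _

lemma H_sech_cont : Continuous sech2 := by
  unfold sech2
  exact (continuous_const.div Real.continuous_cosh fun x => (Real.cosh_pos x).ne').pow 2

lemma H_sech_le (x : ℝ) : sech2 x ≤ 1 := by
  unfold sech2
  have := Real.one_le_cosh x
  rw [div_pow, one_pow, div_le_one (by positivity)]
  nlinarith

lemma H_sech_decay (y : ℝ) : y ^ 2 * sech2 y ≤ 4 * (1 + y ^ 2)⁻¹ := by
  unfold sech2
  have hc : 1 + y ^ 2 / 2 ≤ Real.cosh y := by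
    rw [← Real.cosh_abs, ← sq_abs]
    have h1 := Real.cosh_eq |y|
    have hs : |y| / 2 ≤ Real.sinh (|y| / 2) := Real.self_le_sinh_iff.2 (by positivity)
    have h2 := Real.cosh_two_mul (|y| / 2)
    have h3 := Real.cosh_sq (|y| / 2)
    rw [show 2 * (|y|/2) = |y| by ring] at h2
    have : 0 ≤ |y| := abs_nonneg y
    nlinarith
  have hp : 0 < Real.cosh y := Real.cosh_pos y
  have : (1 + y ^ 2 / 2) ^ 2 ≤ Real.cosh y ^ 2 := by
    apply pow_le_pow_left₀ (by positivity) hc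
  rw [div_pow, one_pow, ← div_eq_mul_inv, mul_one_div, div_le_div_iff₀ (by positivity) (by positivity)]
  nlinarith [sq_nonneg y]

lemma H_sech_int {l : ℝ} (hl : 0 < l) {R : ℝ} (hR : 0 ≤ R) :
    ∫ x in (-R)..R, (x / l) ^ 2 * sech2 (x / l) ≤ 4 * π * l := by
  have hc : Continuous (fun x => (x / l) ^ 2 * sech2 (x / l)) := by
    have := H_sech_cont
    fun_prop
  have hi : Integrable (fun x : ℝ => 4 * (1 + (x / l) ^ 2)⁻¹) :=
    (integrable_inv_one_add_sq.comp_div hl.ne').const_mul 4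
  calc _ ≤ ∫ x in (-R)..R, 4 * (1 + (x / l) ^ 2)⁻¹ :=
        intervalIntegral.integral_mono_on (by linarith) (hc.intervalIntegrable _ _)
          hi.intervalIntegrable (fun x _ => H_sech_decay _)
    _ ≤ ∫ x, 4 * (1 + (x / l) ^ 2)⁻¹ := by
        rw [intervalIntegral.integral_of_le (by linarith)]
        exact setIntegral_le_integral hi (Eventually.of_forall fun x => by positivity)
    _ = _ := by
        rw [integral_const_mul, Measure.integral_comp_div (fun x => (1 + x ^ 2)⁻¹),
          integral_univ_inv_one_add_sq, abs_of_pos hl, smul_eq_mul]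
        ring

/-- derivative of `lam (1/2)` -/
noncomputable def lamp (t : ℝ) : ℝ :=
  (1 / (2 * √t) * Real.log t - √t * t⁻¹) / (Real.log t) ^ 2

lemma H_lam (t : ℝ) : lam (1 / 2) t = √t / Real.log t := by
  rw [lam, Real.sqrt_eq_rpow]

lemma H_lam_pos {t : ℝ} (ht : 1 < t) : 0 < lam (1 / 2) t := by
  rw [H_lam]
  exact div_pos (Real.sqrt_pos.2 (by linarith)) (Real.log_pos ht)

lemma H_lam_deriv {t : ℝ} (ht : 1 < t) : HasDerivAt (lam (1 / 2)) (lamp t) t := by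
  have e : lam (1/2) = fun t => √t / Real.log t := funext H_lam
  rw [e]
  exact (Real.hasDerivAt_sqrt (by linarith)).div (Real.hasDerivAt_log (by linarith))
    (Real.log_pos ht).ne'

lemma H_lamp_cont : ContinuousOn lamp (Set.Ioi 1) := by
  intro t ht
  have h1 : (1:ℝ) < t := ht
  have h2 : t ≠ 0 := by linarith
  have h3 := (Real.log_pos h1).ne'
  have h4 : √t ≠ 0 := (Real.sqrt_pos.2 (by linarith)).ne'
  apply ContinuousAt.continuousWithinAt
  unfold lamp
  have := Real.continuousAt_log h2
  have h5 : ContinuousAt (fun t => √t) t := Real.continuous_sqrt.continuousAt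
  have h6 : ContinuousAt (fun t : ℝ => t⁻¹) t := continuousAt_inv₀ h2
  have h7 : ContinuousAt (fun t : ℝ => 1 / (2 * √t)) t :=
    continuousAt_const.div (continuousAt_const.mul h5) (by positivity)
  exact ((h7.mul this).sub (h5.mul h6)).div (this.pow 2) (by positivity)

lemma H_lamp_le {t : ℝ} (ht : exp 2 ≤ t) : lamp t ^ 2 ≤ 1 / (t * Real.log t ^ 2) := by
  have hp : 0 < t := (exp_pos 2).trans_le ht
  have hL : 2 ≤ Real.log t := (Real.le_log_iff_exp_le hp).2 ht
  have hs : 0 < √t := Real.sqrt_pos.2 hp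
  have e : lamp t = (Real.log t - 2) / (2 * √t * Real.log t ^ 2) := by
    unfold lamp
    have : t⁻¹ = (√t * √t)⁻¹ := by rw [Real.mul_self_sqrt hp.le]
    rw [this]
    field_simp
  rw [e, div_pow, mul_pow, mul_pow, Real.sq_sqrt hp.le, div_le_div_iff₀ (by positivity) (by positivity)]
  have h1 : (Real.log t - 2)^2 ≤ Real.log t ^ 2 := by nlinarith
  have h2 : 0 ≤ t * Real.log t ^ 2 := by positivity
  calc _ ≤ Real.log t ^ 2 * (t * Real.log t ^ 2) := mul_le_mul_of_nonneg_right h1 h2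
    _ ≤ _ := by
      have : 0 ≤ t * (Real.log t ^2)^2 := by positivity
      nlinarith

lemma H_lamp_int {T : ℝ} (hT : exp 2 ≤ T) : ∫ t in (exp 2)..T, lamp t ^ 2 ≤ 1 := by
  have e1 : (1:ℝ) < exp 2 := Real.one_lt_exp_iff.2 (by norm_num)
  have hsub : Set.uIcc (exp 2) T ⊆ Set.Ioi 1 := by
    rw [Set.uIcc_of_le hT]; intro t ht; exact e1.trans_le ht.1
  have hd : ∀ t ∈ Set.uIcc (exp 2) T,
      HasDerivAt (fun t => -(Real.log t)⁻¹) (1 / (t * Real.log t ^ 2)) t := by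
    intro t ht
    have h1 : (1:ℝ) < t := hsub ht
    have hl := Real.log_pos h1
    refine ((Real.hasDerivAt_log (by linarith : t ≠ 0)).inv hl.ne').neg.congr_deriv ?_
    have : 0 < t := by linarith
    field_simp
  have hii : IntervalIntegrable (fun t : ℝ => 1 / (t * Real.log t ^ 2)) volume (exp 2) T := by
    apply ContinuousOn.intervalIntegrable
    intro t ht
    have h1 : (1:ℝ) < t := hsub ht
    have hl := Real.log_pos h1
    have : 0 < t := by linarith
    apply ContinuousAt.continuousWithinAt
    exact continuousAt_const.div (continuousAt_id.mul ((Real.continuousAt_log this.ne').pow 2))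
      (by positivity)
  calc _ ≤ ∫ t in (exp 2)..T, 1 / (t * Real.log t ^ 2) :=
        intervalIntegral.integral_mono_on hT
          ((H_lamp_cont.mono hsub).pow 2).intervalIntegrable hii (fun t ht => H_lamp_le ht.1)
    _ = _ := intervalIntegral.integral_eq_sub_of_hasDerivAt hd hii
    _ ≤ 1 := by
      have : 0 ≤ (Real.log T)⁻¹ := inv_nonneg.2 (Real.log_nonneg (by linarith))
      rw [Real.log_exp]
      linarith

lemma H_tanh_cont : Continuous Real.tanh :=
  continuous_iff_continuousAt.2 fun x => (H_tanh x).continuousAt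

lemma H_virial {l c R : ℝ} (hl : 0 < l) (hR : 0 ≤ R) {v w F : ℝ → ℝ} (hv : Continuous v)
    (hw : Continuous w) (hF : ∀ x, HasDerivAt F (-w x) x) (hF0 : ∀ x, v x ^ 2 / 2 ≤ F x) :
    (1 / (4 * l)) * (∫ x in (-R)..R, sech2 (x / l) * v x ^ 2) - (F R + F (-R)) - 4 * π * c ^ 2
      ≤ ∫ x in (-R)..R, (sech2 (x / l) * (-(x * c) / l ^ 2) * v x + Real.tanh (x / l) * w x) := by
  have hs := H_sech_cont
  have ht := H_tanh_cont
  have hFc : Continuous F := continuous_iff_continuousAt.2 fun x => (hF x).continuousAt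
  have hdt : ∀ x, HasDerivAt (fun x => Real.tanh (x / l)) (sech2 (x / l) * (1 / l)) x := fun x =>
    HasDerivAt.comp (h₂ := Real.tanh) (h := fun x => x / l) x (H_tanh (x / l))
      ((hasDerivAt_id x).div_const l)
  have ibp := intervalIntegral.integral_mul_deriv_eq_deriv_mul (a := -R) (b := R)
    (fun x _ => hdt x) (fun x _ => hF x)
    (Continuous.intervalIntegrable (by fun_prop) _ _)
    (Continuous.intervalIntegrable (by fun_prop) _ _)
  have e1 : ∫ x in (-R)..R, Real.tanh (x / l) * w x
      = (∫ x in (-R)..R, sech2 (x / l) * (1 / l) * F x) - Real.tanh (R / l) * (F R + F (-R)) := by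
    have : ∫ x in (-R)..R, Real.tanh (x / l) * w x
        = - ∫ x in (-R)..R, Real.tanh (x / l) * (-w x) := by
      rw [← intervalIntegral.integral_neg]; congr 1; funext x; ring
    rw [this, ibp, neg_div, Real.tanh_neg]; ring
  rw [intervalIntegral.integral_add (Continuous.intervalIntegrable (by fun_prop) _ _)
    (Continuous.intervalIntegrable (by fun_prop) _ _), e1]
  have e2 : (∫ x in (-R)..R, ((1 / (4 * l)) * (sech2 (x / l) * v x ^ 2)
        - c ^ 2 / l * ((x / l) ^ 2 * sech2 (x / l))))
      ≤ ∫ x in (-R)..R, (sech2 (x / l) * (-(x * c) / l ^ 2) * v x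
        + sech2 (x / l) * (1 / l) * F x) := by
    refine intervalIntegral.integral_mono_on (by linarith)
      (Continuous.intervalIntegrable (by fun_prop) _ _)
      (Continuous.intervalIntegrable (by fun_prop) _ _) fun x _ => ?_
    have h1 : 0 ≤ sech2 (x / l) * (1 / l) := mul_nonneg (H_sech_nonneg _) (by positivity)
    have h2 : 0 ≤ F x - v x ^ 2 / 4 - (x / l) * c * v x + c ^ 2 * (x / l) ^ 2 := by
      nlinarith [hF0 x, sq_nonneg (v x / 2 - (x / l) * c)]
    have h3 := mul_nonneg h1 h2
    have h4 : sech2 (x / l) * (1 / l) * (F x - v x ^ 2 / 4 - (x / l) * c * v x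
        + c ^ 2 * (x / l) ^ 2) = (sech2 (x / l) * (-(x * c) / l ^ 2) * v x
        + sech2 (x / l) * (1 / l) * F x) - ((1 / (4 * l)) * (sech2 (x / l) * v x ^ 2)
        - c ^ 2 / l * ((x / l) ^ 2 * sech2 (x / l))) := by
      field_simp; ring
    linarith
  rw [intervalIntegral.integral_sub (Continuous.intervalIntegrable (by fun_prop) _ _)
    (Continuous.intervalIntegrable (by fun_prop) _ _),
    intervalIntegral.integral_add (Continuous.intervalIntegrable (by fun_prop) _ _)
    (Continuous.intervalIntegrable (by fun_prop) _ _),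
    intervalIntegral.integral_const_mul, intervalIntegral.integral_const_mul] at e2
  have e3 : c ^ 2 / l * (∫ x in (-R)..R, (x / l) ^ 2 * sech2 (x / l)) ≤ 4 * π * c ^ 2 := by
    calc _ ≤ c ^ 2 / l * (4 * π * l) :=
          mul_le_mul_of_nonneg_left (H_sech_int hl hR) (by positivity)
      _ = _ := by field_simp
  have e4 : Real.tanh (R / l) * (F R + F (-R)) ≤ F R + F (-R) := by
    refine mul_le_of_le_one_left ?_ (Real.tanh_lt_one _).le
    have := hF0 R
    have := hF0 (-R)
    nlinarith [sq_nonneg (v R), sq_nonneg (v (-R))]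
  linarith

lemma H_flux {b M : ℝ} (hb : b ∈ Set.Ioo (0 : ℝ) 3) {v : ℝ → ℝ} (hv : ContDiff ℝ 3 v)
    (h0 : Integrable v) (hv2 : Integrable (fun x => v x ^ 2))
    (hd2 : Integrable (fun x => deriv v x ^ 2)) (hd : ∀ x, |deriv v x| ≤ v x)
    (hM : ∫ x, v x = M) (hle : ∀ x, v x ≤ M) (t0 : Tendsto v atTop (nhds 0))
    (b0 : Tendsto v atBot (nhds 0)) {F : ℝ → ℝ}
    (hF : F = fun y => (1 / 2) * (v y) ^ 2
      + G (fun z => (b / 2) * (v z) ^ 2 + ((3 - b) / 2) * (deriv v z) ^ 2) y) :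
    Differentiable ℝ F ∧ (∀ x, v x ^ 2 / 2 ≤ F x) ∧ (∀ x, F x ≤ 2 * M ^ 2) ∧
    Tendsto F atTop (nhds 0) ∧ Tendsto F atBot (nhds 0) := by
  obtain ⟨hb0, hb3⟩ := hb
  have hfi : Integrable (fun z => (b / 2) * (v z) ^ 2 + ((3 - b) / 2) * (deriv v z) ^ 2) :=
    (hv2.const_mul _).add (hd2.const_mul _)
  have nn : ∀ x, 0 ≤ v x := fun x => (abs_nonneg _).trans (hd x)
  have hf0 : ∀ z, 0 ≤ (b / 2) * (v z) ^ 2 + ((3 - b) / 2) * (deriv v z) ^ 2 := fun z => by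
    have : 0 < 3 - b := by linarith
    positivity
  have hf1 : ∀ z, (b / 2) * (v z) ^ 2 + ((3 - b) / 2) * (deriv v z) ^ 2 ≤ (3 / 2 * M) * v z := by
    intro z
    have h1 : deriv v z ^ 2 ≤ v z ^ 2 := sq_le_sq' (by linarith [(abs_le.1 (hd z)).1])
      (abs_le.1 (hd z)).2
    have h2 : v z ^ 2 ≤ M * v z := by nlinarith [hle z, nn z]
    nlinarith
  have hInteg : ∫ z, ((b / 2) * (v z) ^ 2 + ((3 - b) / 2) * (deriv v z) ^ 2) ≤ 3 / 2 * M * M := by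
    calc _ ≤ ∫ z, (3 / 2 * M) * v z := integral_mono hfi (h0.const_mul _) hf1
      _ = _ := by rw [integral_const_mul, hM]
  subst hF
  have hvd : Differentiable ℝ v := hv.differentiable (by norm_num)
  have aux : ∀ {l : Filter ℝ} [l.IsCountablyGenerated], Tendsto v l (nhds 0) →
      (∀ y, Tendsto (fun x : ℝ => |x - y|) l atTop) →
      Tendsto (fun y => (1 / 2) * (v y) ^ 2
      + G (fun z => (b / 2) * (v z) ^ 2 + ((3 - b) / 2) * (deriv v z) ^ 2) y) l (nhds 0) := by
    intro l _ h1 h2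
    have := ((h1.pow 2).const_mul (1/2)).add (H_lim hfi h2)
    simpa using this
  refine ⟨?_, ?_, ?_, ?_, ?_⟩
  · exact ((hvd.pow 2).const_mul _).add (H_diff hfi)
  · intro x
    have := H_nonneg hf0 x
    linarith
  · intro x
    have h1 := H_le hfi hf0 x
    have h2 := hle x
    have h3 := nn x
    nlinarith
  · exact aux t0 fun y => tendsto_abs_atTop_atTop.comp (tendsto_atTop_add_const_right _ (-y) tendsto_id)
  · exact aux b0 fun y => tendsto_abs_atBot_atTop.comp (tendsto_atBot_add_const_right _ (-y) tendsto_id)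
/-- For a global classical `H²` solution with nonnegative momentum and
`λ(t) = t^{1/2}/log t`, there is `t₀ > e` with
`∫_{t₀}^∞ (1/λ(t)) ∫ sech²(x/λ(t)) (u² + (∂ₓu)²) dx dt < ∞`. -/
theorem weighted_local_energy_integrable (b : ℝ) (hb : b ∈ Set.Ioo (0 : ℝ) 3)
    (u : ℝ → ℝ → ℝ) (hu : IsH2NonnegMomentumSolution b u) :
    ∃ t₀ : ℝ, Real.exp 1 < t₀ ∧
      IntegrableOn
        (fun t : ℝ => (1 / lam (1 / 2) t) *
          ∫ x : ℝ, sech2 (x / lam (1 / 2) t) * ((u t x) ^ 2 + (deriv (u t) x) ^ 2))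
        (Set.Ioi t₀) := by
  obtain ⟨hut, hux, cu, cut, cux, -, -, -, heq, hInteg, hm, hmM⟩ := hu
  set M : ℝ := ∫ x : ℝ, mom u 0 x with hMdef
  have sp : ∀ t, 0 ≤ t → (∀ x, |deriv (u t) x| ≤ u t x) ∧ (∫ x, u t x = M) ∧
      (∀ x, u t x ≤ M) ∧ Tendsto (u t) atTop (nhds 0) ∧ Tendsto (u t) atBot (nhds 0) := by
    intro t ht
    obtain ⟨i0, -, i1, -, i2, -⟩ := hInteg t ht
    obtain ⟨h1, h2, h3, h4, h5⟩ := H_spatial (hux t) i0 i1 i2 (fun x => hm t x ht)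
    have h6 : ∫ x, u t x = M := by rw [h2]; exact hmM t ht
    exact ⟨h1, h6, fun x => h6 ▸ h3 x, h4, h5⟩
  have nn : ∀ t, 0 ≤ t → ∀ x, 0 ≤ u t x := fun t ht x => (abs_nonneg _).trans ((sp t ht).1 x)
  have fl : ∀ t, 0 ≤ t → Differentiable ℝ (flux b u t) ∧ (∀ x, u t x ^ 2 / 2 ≤ flux b u t x) ∧
      (∀ x, flux b u t x ≤ 2 * M ^ 2) ∧
      Tendsto (flux b u t) atTop (nhds 0) ∧ Tendsto (flux b u t) atBot (nhds 0) := by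
    intro t ht
    obtain ⟨i0, i02, i1, i12, i2, -⟩ := hInteg t ht
    obtain ⟨h1, h2, h3, h4, h5⟩ := sp t ht
    exact H_flux hb (hux t) i0 i02 i12 h1 h2 h3 h4 h5 rfl
  have fl0 : ∀ t, 0 ≤ t → ∀ x, 0 ≤ flux b u t x := fun t ht x =>
    le_trans (by positivity) ((fl t ht).2.1 x)
  have e1 : (1:ℝ) < exp 2 := Real.one_lt_exp_iff.2 (by norm_num)
  have hs := H_sech_cont
  -- basic measurability
  have lamM : Measurable (lam (1 / 2)) := by
    have e : lam (1/2) = fun t => √t / Real.log t := funext H_lam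
    rw [e]; exact Real.continuous_sqrt.measurable.div Real.measurable_log
  have wM : Measurable (fun p : ℝ × ℝ => sech2 (p.2 / lam (1 / 2) p.1)) :=
    hs.measurable.comp (measurable_snd.div (lamM.comp measurable_fst))
  have flM : ∀ y, StronglyMeasurable (fun t => flux b u t y) := by
    intro y
    have h1 : StronglyMeasurable (fun t => ∫ z : ℝ, Real.exp (-|y - z|) *
        ((b / 2) * (u t z) ^ 2 + ((3 - b) / 2) * (deriv (u t) z) ^ 2)) := by
      refine StronglyMeasurable.integral_prod_right' (f := fun p : ℝ × ℝ =>
        Real.exp (-|y - p.2|) *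
        ((b / 2) * (u p.1 p.2) ^ 2 + ((3 - b) / 2) * (deriv (u p.1) p.2) ^ 2)) ?_
      exact Continuous.stronglyMeasurable (by fun_prop)
    have h2 : Continuous (fun t => u t y) := (hut y).continuous
    exact ((h2.pow 2).stronglyMeasurable.const_mul (1/2)).add (h1.const_mul (1/2))
  have QM : ∀ μ : Measure ℝ, SFinite μ → StronglyMeasurable (fun t => (1 / (4 * lam (1 / 2) t)) *
      ∫ x, sech2 (x / lam (1 / 2) t) * u t x ^ 2 ∂μ) := by
    intro μ _
    refine StronglyMeasurable.mul ?_ (StronglyMeasurable.integral_prod_right'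
      (f := fun p : ℝ × ℝ => sech2 (p.2 / lam (1 / 2) p.1) * u p.1 p.2 ^ 2) ?_)
    · exact (measurable_const.div (lamM.const_mul 4)).stronglyMeasurable
    · exact (wM.mul (cu.pow 2).measurable).stronglyMeasurable
  have hM' : StronglyMeasurable (fun t => (1 / lam (1 / 2) t) *
      ∫ x, sech2 (x / lam (1 / 2) t) * ((u t x) ^ 2 + (deriv (u t) x) ^ 2)) := by
    refine StronglyMeasurable.mul ?_ (StronglyMeasurable.integral_prod_right'
      (f := fun p : ℝ × ℝ => sech2 (p.2 / lam (1 / 2) p.1) *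
        (u p.1 p.2 ^ 2 + deriv (u p.1) p.2 ^ 2)) ?_)
    · exact (measurable_const.div lamM).stronglyMeasurable
    · exact (wM.mul ((cu.pow 2).add (cux.pow 2)).measurable).stronglyMeasurable
  -- spatial integrability
  have wi : ∀ t, 0 ≤ t → Integrable (fun x => sech2 (x / lam (1 / 2) t) * u t x ^ 2) := by
    intro t ht
    refine (hInteg t ht).2.1.bdd_mul (c := 1)
      (Continuous.aestronglyMeasurable (by fun_prop)) ?_
    refine Eventually.of_forall fun x => ?_
    rw [Real.norm_eq_abs, abs_of_nonneg (H_sech_nonneg _)]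
    exact H_sech_le _
  have wd : ∀ t, 0 ≤ t → Integrable (fun x => sech2 (x / lam (1 / 2) t) *
      (u t x ^ 2 + deriv (u t) x ^ 2)) := by
    intro t ht
    refine ((hInteg t ht).2.1.add (hInteg t ht).2.2.2.1).bdd_mul (c := 1)
      (Continuous.aestronglyMeasurable (by fun_prop)) ?_
    refine Eventually.of_forall fun x => ?_
    rw [Real.norm_eq_abs, abs_of_nonneg (H_sech_nonneg _)]
    exact H_sech_le _
  have w0 : ∀ t x, 0 ≤ sech2 (x / lam (1 / 2) t) * u t x ^ 2 := fun t x =>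
    mul_nonneg (H_sech_nonneg _) (sq_nonneg _)
  have wle : ∀ t, 0 ≤ t → ∫ x, sech2 (x / lam (1 / 2) t) * u t x ^ 2 ≤ M ^ 2 := by
    intro t ht
    calc _ ≤ ∫ x, M * u t x := by
          refine integral_mono (wi t ht) ((hInteg t ht).1.const_mul M) fun x => ?_
          have h1 := H_sech_le (x / lam (1 / 2) t)
          have h2 := nn t ht x
          have h3 := (sp t ht).2.2.1 x
          calc _ ≤ u t x ^ 2 := mul_le_of_le_one_left (sq_nonneg _) h1
            _ ≤ M * u t x := by nlinarith
      _ = _ := by rw [integral_const_mul, (sp t ht).2.1]; ring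
  -- the time derivative
  let D : ℝ → ℝ → ℝ := fun t x =>
    sech2 (x / lam (1 / 2) t) * (-(x * lamp t) / lam (1 / 2) t ^ 2) * u t x
      + Real.tanh (x / lam (1 / 2) t) * deriv (fun s => u s x) t
  have hD : ∀ t x, 1 < t →
      HasDerivAt (fun s => Real.tanh (x / lam (1 / 2) s) * u s x) (D t x) t := by
    intro t x ht
    have h1 : HasDerivAt (fun s => x / lam (1 / 2) s) (-(x * lamp t) / lam (1 / 2) t ^ 2) t := by
      refine ((hasDerivAt_const t x).div (H_lam_deriv ht) (H_lam_pos ht).ne').congr_deriv ?_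
      ring
    have h2 := HasDerivAt.comp (h₂ := Real.tanh) t (H_tanh _) h1
    exact h2.mul ((hut x).differentiable (by norm_num) t).hasDerivAt
  have cD : ContinuousOn (fun p : ℝ × ℝ => D p.1 p.2) (Set.Ioi 1 ×ˢ Set.univ) := by
    have cl : ContinuousOn (fun p : ℝ × ℝ => lam (1 / 2) p.1) (Set.Ioi 1 ×ˢ Set.univ) :=
      ContinuousOn.comp (g := lam (1 / 2)) (t := Set.Ioi 1)
        (fun t ht => (H_lam_deriv ht).continuousAt.continuousWithinAt)
        continuous_fst.continuousOn (fun p hp => hp.1)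
    have clp : ContinuousOn (fun p : ℝ × ℝ => lamp p.1) (Set.Ioi 1 ×ˢ Set.univ) :=
      H_lamp_cont.comp continuous_fst.continuousOn (fun p hp => hp.1)
    have ne : ∀ p ∈ (Set.Ioi (1:ℝ) ×ˢ (Set.univ : Set ℝ)), lam (1 / 2) p.1 ≠ 0 :=
      fun p hp => (H_lam_pos hp.1).ne'
    have c1 : ContinuousOn (fun p : ℝ × ℝ => p.2 / lam (1 / 2) p.1) (Set.Ioi 1 ×ˢ Set.univ) :=
      continuous_snd.continuousOn.div cl ne
    exact (((hs.comp_continuousOn c1).mul (((continuous_snd.continuousOn.mul clp).neg).div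
      (cl.pow 2) fun p hp => pow_ne_zero 2 (ne p hp))).mul cu.continuousOn).add
      ((H_tanh_cont.comp_continuousOn c1).mul cut.continuousOn)
  have iD : ∀ T R, exp 2 ≤ T → IntegrableOn (fun p : ℝ × ℝ => D p.1 p.2)
      (Set.uIoc (exp 2) T ×ˢ Set.uIoc (-R) R) := by
    intro T R hT
    refine IntegrableOn.mono_set (t := Set.Icc (exp 2) T ×ˢ Set.uIcc (-R) R) ?_ ?_
    · refine ContinuousOn.integrableOn_compact (isCompact_Icc.prod isCompact_uIcc) (cD.mono ?_)
      exact Set.prod_mono (fun t ht => e1.trans_le ht.1) (Set.subset_univ _)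
    · refine Set.prod_mono ?_ Set.uIoc_subset_uIcc
      rw [Set.uIoc_of_le hT]; exact Set.Ioc_subset_Icc_self
  have lim1 : ∀ T R, exp 2 ≤ T → 0 ≤ R →
      ∫ t in (exp 2)..T, ∫ x in (-R)..R, D t x ≤ 2 * M := by
    intro T R hT hR
    rw [intervalIntegral_intervalIntegral_swap (F := D) (iD T R hT)]
    have e2 : ∀ x, ∫ t in (exp 2)..T, D t x = Real.tanh (x / lam (1 / 2) T) * u T x
        - Real.tanh (x / lam (1 / 2) (exp 2)) * u (exp 2) x := by
      intro x
      refine intervalIntegral.integral_eq_sub_of_hasDerivAt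
        (f := fun s => Real.tanh (x / lam (1 / 2) s) * u s x) (fun t ht => hD t x ?_) ?_
      · rw [Set.uIcc_of_le hT] at ht; exact e1.trans_le ht.1
      · refine ContinuousOn.intervalIntegrable (cD.comp
          (f := fun t : ℝ => (t, x)) (by fun_prop) fun t ht => ⟨?_, trivial⟩)
        rw [Set.uIcc_of_le hT] at ht; exact e1.trans_le ht.1
    simp only [e2]
    have ct := H_tanh_cont
    have T0 : 0 ≤ T := by linarith
    have iT := (hInteg T T0).1
    have ia := (hInteg (exp 2) (exp_pos 2).le).1
    calc _ ≤ ∫ x in (-R)..R, (u T x + u (exp 2) x) := by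
          have := (hux T).continuous
          have := (hux (exp 2)).continuous
          refine intervalIntegral.integral_mono_on (by linarith)
            (Continuous.intervalIntegrable (by fun_prop) _ _)
            (Continuous.intervalIntegrable (by fun_prop) _ _) fun x _ => ?_
          have h1 := nn T T0 x
          have h2 := nn (exp 2) (exp_pos 2).le x
          have h3 := Real.tanh_lt_one (x / lam (1 / 2) T)
          have h4 := Real.neg_one_lt_tanh (x / lam (1 / 2) (exp 2))
          nlinarith
      _ ≤ ∫ x, (u T x + u (exp 2) x) := by
          rw [intervalIntegral.integral_of_le (by linarith)]
          exact setIntegral_le_integral (iT.add ia) (Eventually.of_forall fun x =>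
            add_nonneg (nn T T0 x) (nn (exp 2) (exp_pos 2).le x))
      _ = 2 * M := by
          rw [integral_add iT ia, (sp T T0).2.1, (sp _ (exp_pos 2).le).2.1]; ring
  -- the truncated functional
  let g : ℝ → ℝ → ℝ := fun R t =>
    (1 / (4 * lam (1 / 2) t)) * (∫ x in (-R)..R, sech2 (x / lam (1 / 2) t) * u t x ^ 2)
      - (flux b u t R + flux b u t (-R))
  have gM : ∀ R, 0 ≤ R → StronglyMeasurable (g R) := by
    intro R hR
    refine StronglyMeasurable.sub ?_ ((flM R).add (flM (-R)))
    simp only [intervalIntegral.integral_of_le (show -R ≤ R by linarith)]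
    exact QM _ inferInstance
  have bndI : ∀ T, exp 2 ≤ T → IntervalIntegrable
      (fun t => 1 / (4 * lam (1 / 2) t) * M ^ 2 + 4 * M ^ 2) volume (exp 2) T := by
    intro T hT
    apply ContinuousOn.intervalIntegrable
    rw [Set.uIcc_of_le hT]
    intro t ht
    have h1 : 1 < t := e1.trans_le ht.1
    have h2 := (H_lam_deriv h1).continuousAt
    have h3 := H_lam_pos h1
    exact (((continuousAt_const.div (continuousAt_const.mul h2) (mul_ne_zero four_ne_zero h3.ne')).mul
      continuousAt_const).add continuousAt_const).continuousWithinAt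
  have gB : ∀ R t, 0 ≤ R → 1 < t → ‖g R t‖ ≤ 1 / (4 * lam (1 / 2) t) * M ^ 2 + 4 * M ^ 2 := by
    intro R t hR ht
    have t0 : 0 ≤ t := by linarith
    have h3 := H_lam_pos ht
    have h4 : 0 ≤ 1 / (4 * lam (1 / 2) t) := by positivity
    have h5 : 0 ≤ ∫ x in (-R)..R, sech2 (x / lam (1 / 2) t) * u t x ^ 2 :=
      intervalIntegral.integral_nonneg (by linarith) fun x _ => w0 t x
    have h6 : ∫ x in (-R)..R, sech2 (x / lam (1 / 2) t) * u t x ^ 2 ≤ M ^ 2 := by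
      refine le_trans ?_ (wle t t0)
      rw [intervalIntegral.integral_of_le (by linarith)]
      exact setIntegral_le_integral (wi t t0) (Eventually.of_forall fun x => w0 t x)
    have h7 := mul_le_mul_of_nonneg_left h6 h4
    have h8 := mul_nonneg h4 h5
    have h9 := fl0 t t0 R
    have h10 := fl0 t t0 (-R)
    have h11 := (fl t t0).2.2.1 R
    have h12 := (fl t t0).2.2.1 (-R)
    rw [Real.norm_eq_abs, abs_le]
    constructor
    · simp only [g]; linarith [mul_nonneg h4 (sq_nonneg M)]
    · simp only [g]; linarith [sq_nonneg M]
  have gI : ∀ R T, 0 ≤ R → exp 2 ≤ T → IntervalIntegrable (g R) volume (exp 2) T := by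
    intro R T hR hT
    refine (bndI T hT).mono_fun' (gM R hR).aestronglyMeasurable ?_
    filter_upwards [ae_restrict_mem measurableSet_uIoc] with t ht
    rw [Set.uIoc_of_le hT] at ht
    exact gB R t hR (e1.trans ht.1)
  have lampI : ∀ T, exp 2 ≤ T → IntervalIntegrable (fun t => lamp t ^ 2) volume (exp 2) T := by
    intro T hT
    refine ((H_lamp_cont.mono ?_).pow 2).intervalIntegrable
    rw [Set.uIcc_of_le hT]; intro t ht; exact e1.trans_le ht.1
  have gInt : ∀ R T, 0 ≤ R → exp 2 ≤ T → ∫ t in (exp 2)..T, g R t ≤ 2 * M + 4 * π := by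
    intro R T hR hT
    have iDD : IntervalIntegrable (fun t => ∫ x in (-R)..R, D t x) volume (exp 2) T := by
      rw [intervalIntegrable_iff_integrableOn_Ioc_of_le hT]
      have := iD T R hT
      rw [IntegrableOn, Measure.volume_eq_prod, ← Measure.prod_restrict, Set.uIoc_of_le hT,
        Set.uIoc_of_le (by linarith)] at this
      have := this.integral_prod_left
      simp only [intervalIntegral.integral_of_le (show -R ≤ R by linarith)]
      exact this
    calc _ ≤ ∫ t in (exp 2)..T, ((∫ x in (-R)..R, D t x) + 4 * π * lamp t ^ 2) := by
          refine intervalIntegral.integral_mono_on hT (gI R T hR hT)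
            (iDD.add ((lampI T hT).const_mul _)) fun t ht => ?_
          have h1 : 1 < t := e1.trans_le ht.1
          have t0 : 0 < t := by linarith
          have hF : ∀ x, HasDerivAt (flux b u t) (-(deriv (fun s => u s x) t)) x := by
            intro x
            refine ((fl t t0.le).1 x).hasDerivAt.congr_deriv ?_
            linarith [heq t x t0]
          have := H_virial (c := lamp t) (H_lam_pos h1) hR (hux t).continuous
            (w := fun x => deriv (fun s => u s x) t)
            (cut.comp (f := fun x : ℝ => (t, x)) (by fun_prop)) hF (fl t t0.le).2.1
          simp only [g, D]
          linarith
      _ = (∫ t in (exp 2)..T, ∫ x in (-R)..R, D t x) + 4 * π * ∫ t in (exp 2)..T, lamp t ^ 2 := by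
          rw [intervalIntegral.integral_add iDD ((lampI T hT).const_mul _),
            intervalIntegral.integral_const_mul]
      _ ≤ 2 * M + 4 * π := by
          have h1 := lim1 T R hT hR
          have h2 := H_lamp_int hT
          have h3 := Real.pi_pos
          nlinarith
  let Q : ℝ → ℝ := fun t => (1 / (4 * lam (1 / 2) t)) *
      ∫ x, sech2 (x / lam (1 / 2) t) * u t x ^ 2
  have QInt : ∀ T, exp 2 ≤ T → ∫ t in (exp 2)..T, Q t ≤ 2 * M + 4 * π := by
    intro T hT
    have lim : Tendsto (fun R => ∫ t in (exp 2)..T, g R t) atTop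
        (nhds (∫ t in (exp 2)..T, Q t)) := by
      refine intervalIntegral.tendsto_integral_filter_of_dominated_convergence _ ?_ ?_
        (bndI T hT) ?_
      · filter_upwards [eventually_ge_atTop 0] with R hR using (gM R hR).aestronglyMeasurable
      · filter_upwards [eventually_ge_atTop 0] with R hR
        refine Eventually.of_forall fun t ht => ?_
        rw [Set.uIoc_of_le hT] at ht
        exact gB R t hR (e1.trans ht.1)
      · refine Eventually.of_forall fun t ht => ?_
        rw [Set.uIoc_of_le hT] at ht
        have t0 : 0 ≤ t := by linarith [ht.1]
        have h1 := intervalIntegral_tendsto_integral (wi t t0) tendsto_neg_atTop_atBot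
          (tendsto_id (α := ℝ))
        have h2 := (fl t t0).2.2.2.1
        have h3 := (fl t t0).2.2.2.2.comp tendsto_neg_atTop_atBot
        have := (h1.const_mul (1 / (4 * lam (1 / 2) t))).sub (h2.add h3)
        simp only [add_zero, sub_zero] at this
        exact this
    exact le_of_tendsto lim (by
      filter_upwards [eventually_ge_atTop 0] with R hR using gInt R T hR hT)
  have Qle : ∀ t, 1 < t → Q t ≤ 1 / (4 * lam (1 / 2) t) * M ^ 2 + 4 * M ^ 2 := by
    intro t ht
    have h3 := H_lam_pos ht
    have h4 : 0 ≤ 1 / (4 * lam (1 / 2) t) := by positivity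
    have := mul_le_mul_of_nonneg_left (wle t (by linarith)) h4
    simp only [Q]
    linarith [sq_nonneg M]
  have Q0 : ∀ t, 1 < t → 0 ≤ Q t := by
    intro t ht
    have h3 := H_lam_pos ht
    exact mul_nonneg (by positivity) (integral_nonneg fun x => w0 t x)
  have QI : ∀ T, exp 2 ≤ T → IntervalIntegrable Q volume (exp 2) T := by
    intro T hT
    refine (bndI T hT).mono_fun' (QM volume inferInstance).aestronglyMeasurable ?_
    filter_upwards [ae_restrict_mem measurableSet_uIoc] with t ht
    rw [Set.uIoc_of_le hT] at ht
    have h1 := e1.trans ht.1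
    rw [Real.norm_eq_abs, abs_of_nonneg (Q0 t h1)]
    exact Qle t h1
  have hle : ∀ t, 1 < t → ‖(1 / lam (1 / 2) t) *
      ∫ x, sech2 (x / lam (1 / 2) t) * ((u t x) ^ 2 + (deriv (u t) x) ^ 2)‖ ≤ 8 * Q t := by
    intro t ht
    have t0 : 0 ≤ t := by linarith
    have h3 := H_lam_pos ht
    have h4 : 0 ≤ ∫ x, sech2 (x / lam (1 / 2) t) * ((u t x) ^ 2 + (deriv (u t) x) ^ 2) :=
      integral_nonneg fun x => mul_nonneg (H_sech_nonneg _) (by positivity)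
    rw [Real.norm_eq_abs, abs_of_nonneg (mul_nonneg (by positivity) h4)]
    have h5 : ∫ x, sech2 (x / lam (1 / 2) t) * ((u t x) ^ 2 + (deriv (u t) x) ^ 2)
        ≤ 2 * ∫ x, sech2 (x / lam (1 / 2) t) * u t x ^ 2 := by
      rw [← integral_const_mul]
      refine integral_mono (wd t t0) ((wi t t0).const_mul 2) fun x => ?_
      have h6 := (sp t t0).1 x
      have h7 : deriv (u t) x ^ 2 ≤ u t x ^ 2 :=
        sq_le_sq' (by linarith [(abs_le.1 h6).1]) (abs_le.1 h6).2
      have h8 := mul_le_mul_of_nonneg_left h7 (H_sech_nonneg (x / lam (1 / 2) t))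
      simp only
      linarith
    have h9 := mul_le_mul_of_nonneg_left h5 (show 0 ≤ 1 / lam (1 / 2) t by positivity)
    refine h9.trans (le_of_eq ?_)
    simp only [Q]
    field_simp
    ring
  refine ⟨exp 2, Real.exp_lt_exp.2 (by norm_num), ?_⟩
  have hI : ∀ T, exp 2 ≤ T → IntervalIntegrable (fun t => (1 / lam (1 / 2) t) *
      ∫ x, sech2 (x / lam (1 / 2) t) * ((u t x) ^ 2 + (deriv (u t) x) ^ 2))
      volume (exp 2) T := by
    intro T hT
    refine ((QI T hT).const_mul 8).mono_fun' hM'.aestronglyMeasurable ?_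
    filter_upwards [ae_restrict_mem measurableSet_uIoc] with t ht
    rw [Set.uIoc_of_le hT] at ht
    exact hle t (e1.trans ht.1)
  refine integrableOn_Ioi_of_intervalIntegral_norm_bounded (b := fun T : ℝ => max (exp 2) T)
    (l := atTop) (8 * (2 * M + 4 * π)) (exp 2) (fun T => ?_)
    (tendsto_atTop_mono (fun T => le_max_right _ _) tendsto_id)
    (Eventually.of_forall fun T => ?_)
  · exact (intervalIntegrable_iff_integrableOn_Ioc_of_le (le_max_left _ _)).1
      (hI _ (le_max_left _ _))
  · have hT : exp 2 ≤ max (exp 2) T := le_max_left _ _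
    calc _ ≤ ∫ t in (exp 2)..(max (exp 2) T), 8 * Q t :=
          intervalIntegral.integral_mono_on hT (hI _ hT).norm ((QI _ hT).const_mul 8)
            fun t ht => hle t (e1.trans_le ht.1)
      _ ≤ _ := by
          rw [intervalIntegral.integral_const_mul]
          exact mul_le_mul_of_nonneg_left (QInt _ hT) (by norm_num)
end
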